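/- arXiv:2402.15661 — 4 statements merged into one kernel-verified Lean document; each statement's English description precedes it below -/
import Mathlib

section
/- Let X be a separable real Banach space. Then the dual X* has Property(M*) if and only if X has Property(M) and ℓ₁ does not embed isomorphically into X. -/
open Filter Topology ZeroAtInfty

/-- A sequence converges weakly to zero. -/
def WeakNull {E : Type*} [NormedAddCommGroup E] [NormedSpace ℝ E] (x : ℕ → E) : Prop :=
  ∀ f : E →L[ℝ] ℝ, Tendsto (fun n => f (x n)) atTop (nhds 0)

/-- Property (M). -/
def PropertyM (E : Type*) [NormedAddCommGroup E] [NormedSpace ℝ E] : Prop :=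
  ∀ x : ℕ → E, WeakNull x → ∀ u v : E, ‖u‖ ≤ ‖v‖ →
    Filter.limsup (fun n => ‖x n + u‖) atTop ≤ Filter.limsup (fun n => ‖x n + v‖) atTop

/-- `F` embeds isomorphically into `E`. -/
def EmbedsIso (F E : Type*) [NormedAddCommGroup F] [NormedSpace ℝ F]
    [NormedAddCommGroup E] [NormedSpace ℝ E] : Prop :=
  ∃ T : F →L[ℝ] E, Function.Injective T ∧ ∃ c > (0 : ℝ), ∀ y, c * ‖y‖ ≤ ‖T y‖

/-- Weak normal structure. -/
def WeakNormalStructure (E : Type*) [NormedAddCommGroup E] [NormedSpace ℝ E] : Prop :=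
  ∀ C : Set E, Convex ℝ C → IsCompact (toWeakSpace ℝ E '' C) → C.Nontrivial →
    ∃ x ∈ C, sSup ((fun y => ‖x - y‖) '' C) < Metric.diam C

/-- Property (K). -/
def PropertyK (E : Type*) [NormedAddCommGroup E] [NormedSpace ℝ E] : Prop :=
  ∃ K : ℝ, 0 ≤ K ∧ K < 1 ∧ ∀ (x : ℕ → E) (y : E), WeakNull x →
    Tendsto (fun n => ‖x n‖) atTop (nhds 1) →
    Filter.liminf (fun n => ‖x n - y‖) atTop ≤ 1 → ‖y‖ ≤ K

/-- Kadec-Klee norm. -/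
def KadecKlee (E : Type*) [NormedAddCommGroup E] [NormedSpace ℝ E] : Prop :=
  ∀ (x : ℕ → E) (y : E),
    (∀ f : E →L[ℝ] ℝ, Tendsto (fun n => f (x n)) atTop (nhds (f y))) →
    Tendsto (fun n => ‖x n‖) atTop (nhds ‖y‖) →
    Tendsto (fun n => ‖x n - y‖) atTop (nhds 0)

/-- Opial's modulus. -/
noncomputable def opialModulus (E : Type*) [NormedAddCommGroup E] [NormedSpace ℝ E]
    (c : ℝ) : ℝ :=
  sInf { r : ℝ | ∃ (x : ℕ → E) (y : E), c ≤ ‖y‖ ∧ WeakNull x ∧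
    1 ≤ Filter.liminf (fun n => ‖x n‖) atTop ∧
    r = Filter.liminf (fun n => ‖x n - y‖) atTop - 1 }

/-- A sequence of functionals converges weak-star to zero. -/
def WeakStarNull {E : Type*} [NormedAddCommGroup E] [NormedSpace ℝ E]
    (f : ℕ → (E →L[ℝ] ℝ)) : Prop :=
  ∀ x : E, Tendsto (fun n => f n x) atTop (nhds 0)

/-- Property (M*) of the dual. -/
def PropertyMStar (E : Type*) [NormedAddCommGroup E] [NormedSpace ℝ E] : Prop :=
  ∀ f : ℕ → (E →L[ℝ] ℝ), WeakStarNull f → ∀ u v : E →L[ℝ] ℝ, ‖u‖ ≤ ‖v‖ →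
    Filter.limsup (fun n => ‖f n + u‖) atTop ≤ Filter.limsup (fun n => ‖f n + v‖) atTop

/-- Property (K*) of the dual. -/
def PropertyKStar (E : Type*) [NormedAddCommGroup E] [NormedSpace ℝ E] : Prop :=
  ∃ K : ℝ, 0 ≤ K ∧ K < 1 ∧ ∀ (f : ℕ → (E →L[ℝ] ℝ)) (g : E →L[ℝ] ℝ), WeakStarNull f →
    Tendsto (fun n => ‖f n‖) atTop (nhds 1) →
    Filter.liminf (fun n => ‖f n - g‖) atTop ≤ 1 → ‖g‖ ≤ K

/-- weak* Kadec-Klee norm on the dual. -/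
def WeakStarKadecKlee (E : Type*) [NormedAddCommGroup E] [NormedSpace ℝ E] : Prop :=
  ∀ (f : ℕ → (E →L[ℝ] ℝ)) (g : E →L[ℝ] ℝ),
    (∀ x : E, Tendsto (fun n => f n x) atTop (nhds (g x))) →
    Tendsto (fun n => ‖f n‖) atTop (nhds ‖g‖) →
    Tendsto (fun n => ‖f n - g‖) atTop (nhds 0)

/-- weak* Opial modulus of the dual. -/
noncomputable def weakStarOpialModulus (E : Type*) [NormedAddCommGroup E] [NormedSpace ℝ E]
    (c : ℝ) : ℝ :=
  sInf { r : ℝ | ∃ (f : ℕ → (E →L[ℝ] ℝ)) (g : E →L[ℝ] ℝ), c ≤ ‖g‖ ∧ WeakStarNull f ∧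
    1 ≤ Filter.liminf (fun n => ‖f n‖) atTop ∧
    r = Filter.liminf (fun n => ‖f n - g‖) atTop - 1 }

/-- WORTH* for the dual. -/
def WORTHStar (E : Type*) [NormedAddCommGroup E] [NormedSpace ℝ E] : Prop :=
  ∀ f : ℕ → (E →L[ℝ] ℝ), WeakStarNull f → ∀ g : E →L[ℝ] ℝ,
    Tendsto (fun n => ‖f n - g‖ - ‖f n + g‖) atTop (nhds 0)

/-- Reflexivity of a normed space. -/
def IsReflexive (E : Type*) [NormedAddCommGroup E] [NormedSpace ℝ E] : Prop :=
  Function.Surjective (NormedSpace.inclusionInDoubleDual ℝ E)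

/-- The fixed point property for nonexpansive maps. -/
def FPP (E : Type*) [NormedAddCommGroup E] [NormedSpace ℝ E] : Prop :=
  ∀ C : Set E, C.Nonempty → IsClosed C → Bornology.IsBounded C → Convex ℝ C →
    ∀ T : E → E, Set.MapsTo T C C →
      (∀ x ∈ C, ∀ y ∈ C, ‖T x - T y‖ ≤ ‖x - y‖) → ∃ x ∈ C, T x = x

/-- `E` contains an asymptotically isometric copy of `c₀`. -/
def ContainsAsympIsoC0 (E : Type*) [NormedAddCommGroup E] [NormedSpace ℝ E] : Prop :=
  ∃ ε : ℕ → ℝ, (∀ n, ε n ∈ Set.Ioo (0 : ℝ) 1) ∧ Tendsto ε atTop (nhds 0) ∧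
    ∃ x : ℕ → E, ∀ t : ℕ →₀ ℝ,
      (∀ n, (1 - ε n) * |t n| ≤ ‖∑ n ∈ t.support, t n • x n‖) ∧
      ‖∑ n ∈ t.support, t n • x n‖ ≤ ⨆ n, |t n|

/-- `E` contains an asymptotically isometric copy of `ℓ₁`. -/
def ContainsAsympIsoL1 (E : Type*) [NormedAddCommGroup E] [NormedSpace ℝ E] : Prop :=
  ∃ ε : ℕ → ℝ, (∀ n, ε n ∈ Set.Ioo (0 : ℝ) 1) ∧ Tendsto ε atTop (nhds 0) ∧
    ∃ x : ℕ → E, ∀ t : ℕ →₀ ℝ,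
      (∑ n ∈ t.support, (1 - ε n) * |t n| ≤ ‖∑ n ∈ t.support, t n • x n‖) ∧
      ‖∑ n ∈ t.support, t n • x n‖ ≤ ∑ n ∈ t.support, |t n|

/-- Countably many properties of infinite sets that pass to almost-subsets can be decided
simultaneously by passing to a single infinite set. -/
theorem exists_infinite_deciding (Q : ℕ → Set ℕ → Prop)
    (hQ : ∀ j M M', (M' \ M).Finite → Q j M → Q j M') :
    ∃ M : Set ℕ, M.Infinite ∧ ∀ j, Q j M ∨ ∀ M' ⊆ M, M'.Infinite → ¬ Q j M' := by
  have step : ∀ (j : ℕ) (M : {M : Set ℕ // M.Infinite}), ∃ M' : {M : Set ℕ // M.Infinite},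
      M'.1 ⊆ M.1 ∧ (Q j M'.1 ∨ ∀ N ⊆ M.1, N.Infinite → ¬ Q j N) := by
    intro j M
    by_cases h : ∃ N ⊆ M.1, N.Infinite ∧ Q j N
    · obtain ⟨N, hN, hi, hq⟩ := h
      exact ⟨⟨N, hi⟩, hN, Or.inl hq⟩
    · push Not at h
      exact ⟨M, subset_rfl, Or.inr h⟩
  choose next hsub hdec using step
  let S : ℕ → {M : Set ℕ // M.Infinite} :=
    fun n => Nat.rec ⟨Set.univ, Set.infinite_univ⟩ (fun j M => next j M) n
  have hS : ∀ j, S (j + 1) = next j (S j) := fun j => rfl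
  have hanti : Antitone fun n => (S n).1 :=
    antitone_nat_of_succ_le fun j => by rw [hS]; exact hsub j (S j)
  have hpick : ∀ n k : ℕ, ∃ m ∈ (S n).1, k < m := fun n k => (S n).2.exists_gt k
  choose pick hpick_mem hpick_gt using hpick
  let m : ℕ → ℕ := fun n => Nat.rec (pick 0 0) (fun j k => pick (j + 1) k) n
  have hm_mem : ∀ n, m n ∈ (S n).1 := by
    intro n
    cases n with
    | zero => exact hpick_mem 0 0
    | succ j => exact hpick_mem (j + 1) (m j)
  have hm_mono : StrictMono m := strictMono_nat_of_lt_succ fun j => hpick_gt (j + 1) (m j)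
  have halmost : ∀ n, (Set.range m \ (S n).1).Finite := by
    intro n
    refine ((Set.finite_Iio n).image m).subset ?_
    rintro _ ⟨⟨i, rfl⟩, hi⟩
    refine ⟨i, ?_, rfl⟩
    by_contra hlt
    exact hi (hanti (not_lt.mp hlt) (hm_mem i))
  refine ⟨Set.range m, Set.infinite_range_of_injective hm_mono.injective, fun j => ?_⟩
  rcases hdec j (S j) with h | h
  · exact Or.inl (hQ j _ _ (halmost (j + 1)) (by rw [hS]; exact h))
  · refine Or.inr fun M' hM' hi hq => ?_
    have hfin : (M' \ (S j).1).Finite := (halmost j).subset (Set.sdiff_subset_sdiff_left hM')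
    refine h (M' ∩ (S j).1) Set.inter_subset_right ?_ (hQ j M' _ ?_ hq)
    · intro hf
      exact hi ((hf.union hfin).subset fun a ha => by
        by_cases hs : a ∈ (S j).1
        · exact Or.inl ⟨ha, hs⟩
        · exact Or.inr ⟨ha, hs⟩)
    · simp [Set.sdiff_eq_empty.mpr Set.inter_subset_left]

/-- The points belonging to `A n` and to `B n` for infinitely many `n ∈ M`. -/
def oscSet {K : Type*} (A B : ℕ → Set K) (M : Set ℕ) : Set K :=
  {t | {n ∈ M | t ∈ A n}.Infinite ∧ {n ∈ M | t ∈ B n}.Infinite}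

theorem oscSet_mono_almost {K : Type*} (A B : ℕ → Set K) {M M' : Set ℕ} (h : (M' \ M).Finite) :
    oscSet A B M' ⊆ oscSet A B M := by
  have key : ∀ p : ℕ → Prop, {n ∈ M' | p n}.Infinite → {n ∈ M | p n}.Infinite := by
    intro p hp hf
    refine hp ((hf.union h).subset fun n hn => ?_)
    by_cases hM : n ∈ M
    · exact Or.inl ⟨hM, hn.2⟩
    · exact Or.inr ⟨hn.1, hM⟩
  exact fun t ht => ⟨key _ ht.1, key _ ht.2⟩

/-- The points following the pattern `F` on the finite set `S`. -/
def patternSet {K : Type*} (A B : ℕ → Set K) (S F : Finset ℕ) : Set K :=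
  {t | ∀ n ∈ S, (n ∈ F → t ∈ A n) ∧ (n ∉ F → t ∈ B n)}

theorem exists_extend_pattern {K : Type*} (A B : ℕ → Set K) (M : Set ℕ) (S : Finset ℕ)
    (hstable : ∀ M' ⊆ M, M'.Infinite → ∀ F : Finset ℕ,
      (oscSet A B M ∩ patternSet A B S F).Nonempty →
        (oscSet A B M' ∩ patternSet A B S F).Nonempty)
    (hS : ∀ F : Finset ℕ, (oscSet A B M ∩ patternSet A B S F).Nonempty)
    (hM : M.Infinite) (P : Finset (Finset ℕ)) :
    ∃ M' ⊆ M, M'.Infinite ∧ ∀ F ∈ P, ∀ n ∈ M',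
      (oscSet A B M ∩ patternSet A B S F ∩ A n).Nonempty ∧
      (oscSet A B M ∩ patternSet A B S F ∩ B n).Nonempty := by
  induction P using Finset.induction_on with
  | empty => exact ⟨M, subset_rfl, hM, by simp⟩
  | insert F P _ ih =>
    obtain ⟨M₁, h₁, hi₁, hP⟩ := ih
    obtain ⟨t, ht, htF⟩ := hstable M₁ h₁ hi₁ F (hS F)
    have hsub₂ : {n ∈ M₁ | t ∈ A n} ⊆ M₁ := Set.sep_subset _ _
    obtain ⟨t', ht', htF'⟩ := hstable _ (hsub₂.trans h₁) ht.1 F (hS F)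
    have hsub₃ : {n ∈ {n ∈ M₁ | t ∈ A n} | t' ∈ B n} ⊆ {n ∈ M₁ | t ∈ A n} := Set.sep_subset _ _
    have hle : ∀ {N : Set ℕ}, N ⊆ M → oscSet A B N ⊆ oscSet A B M := fun hN =>
      oscSet_mono_almost A B (by simp [Set.sdiff_eq_empty.mpr hN])
    refine ⟨_, hsub₃.trans (hsub₂.trans h₁), ht'.2, fun G hG n hn => ?_⟩
    rcases Finset.mem_insert.mp hG with rfl | hG
    · exact ⟨⟨t, ⟨hle h₁ ht, htF⟩, hn.1.2⟩, ⟨t', ⟨hle (hsub₂.trans h₁) ht', htF'⟩, hn.2⟩⟩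
    · exact hP G hG n hn.1.1

theorem exists_independent_subseq {K : Type*} (A B : ℕ → Set K) (M : Set ℕ) (hM : M.Infinite)
    (hne : (oscSet A B M).Nonempty)
    (hstable : ∀ M' ⊆ M, M'.Infinite → ∀ S F : Finset ℕ,
      (oscSet A B M ∩ patternSet A B S F).Nonempty →
        (oscSet A B M' ∩ patternSet A B S F).Nonempty) :
    ∃ φ : ℕ → ℕ, StrictMono φ ∧ ∀ (k : ℕ) (P : ℕ → Prop),
      ∃ t, ∀ i < k, (P i → t ∈ A (φ i)) ∧ (¬ P i → t ∈ B (φ i)) := by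
  classical
  let Good : Finset ℕ → Prop := fun S =>
    ∀ F : Finset ℕ, (oscSet A B M ∩ patternSet A B S F).Nonempty
  have step : ∀ S : {S // Good S}, ∃ n, (∀ i ∈ S.1, i < n) ∧ Good (insert n S.1) := by
    rintro ⟨S, hS⟩
    obtain ⟨M', -, hi, hP⟩ := exists_extend_pattern A B M S (fun N hN hNi => hstable N hN hNi S)
      hS hM S.powerset
    obtain ⟨n, hn, hgt⟩ := hi.exists_gt (S.sup id)
    have hlt : ∀ i ∈ S, i < n := fun i hi => lt_of_le_of_lt (Finset.le_sup (f := id) hi) hgt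
    refine ⟨n, hlt, fun F => ?_⟩
    have hFS : F ∩ S ∈ S.powerset := Finset.mem_powerset.mpr Finset.inter_subset_right
    have hpat : ∀ t, t ∈ patternSet A B S (F ∩ S) → ∀ i ∈ S,
        (i ∈ F → t ∈ A i) ∧ (i ∉ F → t ∈ B i) := fun t ht i hi =>
      ⟨fun h => (ht i hi).1 (Finset.mem_inter.mpr ⟨h, hi⟩),
        fun h => (ht i hi).2 fun h' => h (Finset.mem_inter.mp h').1⟩
    obtain ⟨⟨t, ⟨ht, htp⟩, htA⟩, ⟨t', ⟨ht', htp'⟩, htB⟩⟩ := hP _ hFS n hn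
    by_cases hnF : n ∈ F
    · refine ⟨t, ht, fun i hi => ?_⟩
      rcases Finset.mem_insert.mp hi with rfl | hi
      · exact ⟨fun _ => htA, fun h => absurd hnF h⟩
      · exact hpat t htp i hi
    · refine ⟨t', ht', fun i hi => ?_⟩
      rcases Finset.mem_insert.mp hi with rfl | hi
      · exact ⟨fun h => absurd h hnF, fun _ => htB⟩
      · exact hpat t' htp' i hi
  choose new hnew hgood using step
  have hempty : Good ∅ := fun F => by
    obtain ⟨t, ht⟩ := hne
    exact ⟨t, ht, fun n hn => absurd hn (Finset.notMem_empty n)⟩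
  let S : ℕ → {S // Good S} :=
    fun n => Nat.rec ⟨∅, hempty⟩ (fun _ T => ⟨insert (new T) T.1, hgood T⟩) n
  let φ : ℕ → ℕ := fun n => new (S n)
  have hSsucc : ∀ n, (S (n + 1)).1 = insert (φ n) (S n).1 := fun n => rfl
  have hmem : ∀ k, ∀ i < k, φ i ∈ (S k).1 := by
    intro k
    induction k with
    | zero => intro i hi; omega
    | succ k ih =>
      intro i hi
      rw [hSsucc]
      rcases Nat.lt_succ_iff_lt_or_eq.mp hi with h | rfl
      · exact Finset.mem_insert_of_mem (ih i h)
      · exact Finset.mem_insert_self _ _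
  have hmono : StrictMono φ := strictMono_nat_of_lt_succ fun n =>
    hnew (S (n + 1)) _ (hmem (n + 1) n n.lt_succ_self)
  refine ⟨φ, hmono, fun k P => ?_⟩
  obtain ⟨t, -, ht⟩ := (S k).2 (((Finset.range k).filter P).image φ)
  refine ⟨t, fun i hi => ⟨fun hP => (ht _ (hmem k i hi)).1 ?_,
    fun hP => (ht _ (hmem k i hi)).2 ?_⟩⟩
  · exact Finset.mem_image_of_mem _ (by simp [hi, hP])
  · intro h
    obtain ⟨j, hj, hji⟩ := Finset.mem_image.mp h
    rw [hmono.injective hji] at hj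
    exact hP (Finset.mem_filter.mp hj).2

/-- Rosenthal's dichotomy for countably many sequences of pairs of sets. -/
theorem rosenthal_dichotomy {K ι : Type*} [Countable ι] [Nonempty ι] (A B : ι → ℕ → Set K) :
    (∃ φ : ℕ → ℕ, StrictMono φ ∧ ∀ i t,
      ¬ ((∃ᶠ n in atTop, t ∈ A i (φ n)) ∧ ∃ᶠ n in atTop, t ∈ B i (φ n))) ∨
    ∃ i, ∃ φ : ℕ → ℕ, StrictMono φ ∧ ∀ (k : ℕ) (P : ℕ → Prop),
      ∃ t, ∀ j < k, (P j → t ∈ A i (φ j)) ∧ (¬ P j → t ∈ B i (φ j)) := by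
  obtain ⟨enum, henum⟩ := exists_surjective_nat (ι × Finset ℕ × Finset ℕ)
  let Q : ℕ → Set ℕ → Prop := fun j M =>
    oscSet (A (enum j).1) (B (enum j).1) M ∩
      patternSet (A (enum j).1) (B (enum j).1) (enum j).2.1 (enum j).2.2 = ∅
  obtain ⟨M, hM, hdec⟩ := exists_infinite_deciding Q fun j M M' hfin hq =>
    Set.subset_eq_empty (Set.inter_subset_inter_left _ (oscSet_mono_almost _ _ hfin)) hq
  by_cases hall : ∀ i, oscSet (A i) (B i) M = ∅
  · left
    refine ⟨Nat.nth (· ∈ M), Nat.nth_strictMono hM, fun i t ⟨hA, hB⟩ => ?_⟩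
    have key : ∀ C : ℕ → Set K, (∃ᶠ n in atTop, t ∈ C (Nat.nth (· ∈ M) n)) →
        {n ∈ M | t ∈ C n}.Infinite := by
      intro C hC
      refine ((Nat.frequently_atTop_iff_infinite.mp hC).image
        (Nat.nth_strictMono hM).injective.injOn).mono ?_
      rintro _ ⟨n, hn, rfl⟩
      exact ⟨Nat.nth_mem_of_infinite hM n, hn⟩
    have : t ∈ oscSet (A i) (B i) M := ⟨key _ hA, key _ hB⟩
    rw [hall i] at this
    exact this
  · right
    push Not at hall
    obtain ⟨i, hi⟩ := hall
    refine ⟨i, exists_independent_subseq (A i) (B i) M hM hi fun M' hM' hi' S F hne => ?_⟩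
    obtain ⟨j, hj⟩ := henum (i, S, F)
    rcases hdec j with h | h
    · simp only [Q, hj] at h
      exact absurd h hne.ne_empty
    · have := h M' hM' hi'
      simp only [Q, hj] at this
      exact Set.nonempty_iff_ne_empty.mpr this


lemma lp_one_summable (a : lp (fun _ : ℕ => ℝ) 1) : Summable fun n => |a n| := by
  have h := (memℓp_gen_iff (by norm_num : 0 < (1 : ENNReal).toReal)).1 (lp.memℓp a)
  simpa using h

lemma lp_one_norm (a : lp (fun _ : ℕ => ℝ) 1) : ‖a‖ = ∑' n, |a n| := by
  have h := lp.norm_eq_tsum_rpow (by norm_num : 0 < (1 : ENNReal).toReal) a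
  simpa using h

section Embedding

variable {X : Type*} [NormedAddCommGroup X] [NormedSpace ℝ X] [CompleteSpace X]

/-- A bounded sequence dominating the `ℓ₁` basis from above spans a copy of `ℓ₁`. -/
lemma embedsIso_lp_one {y : ℕ → X} (hy : ∀ n, ‖y n‖ ≤ 1) {c : ℝ} (hc : 0 < c)
    (hlow : ∀ (a : ℕ → ℝ) (k : ℕ),
      c * ∑ j ∈ Finset.range k, |a j| ≤ ‖∑ j ∈ Finset.range k, a j • y j‖) :
    EmbedsIso (lp (fun _ : ℕ => ℝ) 1) X := by
  have hle : ∀ (a : lp (fun _ : ℕ => ℝ) 1) (n : ℕ), ‖a n • y n‖ ≤ |a n| := fun a n => by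
    rw [norm_smul, Real.norm_eq_abs]
    exact mul_le_of_le_one_right (abs_nonneg _) (hy n)
  have hsum : ∀ a : lp (fun _ : ℕ => ℝ) 1, Summable fun n => a n • y n := fun a =>
    Summable.of_norm_bounded (lp_one_summable a) (hle a)
  let L : lp (fun _ : ℕ => ℝ) 1 →ₗ[ℝ] X :=
    { toFun := fun a => ∑' n, a n • y n
      map_add' := fun a b => by
        rw [← (hsum a).tsum_add (hsum b)]
        simp [add_smul]
      map_smul' := fun r a => by
        simp only [RingHom.id_apply]
        rw [← (hsum a).tsum_const_smul r]
        simp [mul_smul] }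
  have hL : ∀ a, ‖L a‖ ≤ 1 * ‖a‖ := fun a => by
    rw [one_mul, lp_one_norm]
    exact tsum_of_norm_bounded (lp_one_summable a).hasSum (hle a)
  have hlowL : ∀ a, c * ‖a‖ ≤ ‖L a‖ := fun a => by
    rw [lp_one_norm]
    exact le_of_tendsto_of_tendsto
      ((lp_one_summable a).hasSum.tendsto_sum_nat.const_mul c)
      (hsum a).hasSum.tendsto_sum_nat.norm (Eventually.of_forall fun k => hlow (fun n => a n) k)
  refine ⟨L.mkContinuous 1 hL, ?_, c, hc, hlowL⟩
  refine (injective_iff_map_eq_zero _).2 fun a ha => ?_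
  have h := hlowL a
  rw [show L a = 0 from ha, norm_zero] at h
  exact norm_le_zero_iff.1 (by nlinarith [norm_nonneg a])

/-- Rosenthal's `ℓ₁` theorem, for a sequence in the unit ball. -/
theorem exists_weakCauchy_subseq (hX : ¬ EmbedsIso (lp (fun _ : ℕ => ℝ) 1) X)
    {x : ℕ → X} (hx : ∀ n, ‖x n‖ ≤ 1) :
    ∃ φ : ℕ → ℕ, StrictMono φ ∧
      ∀ h : X →L[ℝ] ℝ, ∃ l, Tendsto (fun n => h (x (φ n))) atTop (𝓝 l) := by
  rcases rosenthal_dichotomy (ι := ℚ × ℚ)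
      (fun i n => {h : X →L[ℝ] ℝ | (i.1 < i.2 ∧ ‖h‖ ≤ 1) ∧ h (x n) < i.1})
      (fun i n => {h : X →L[ℝ] ℝ | ‖h‖ ≤ 1 ∧ (i.2 : ℝ) < h (x n)}) with
    ⟨φ, hφ, H⟩ | ⟨⟨r, s⟩, φ, hφ, H⟩
  · refine ⟨φ, hφ, fun h => ?_⟩
    have key : ∀ h : X →L[ℝ] ℝ, ‖h‖ ≤ 1 → ∃ l, Tendsto (fun n => h (x (φ n))) atTop (𝓝 l) := by
      intro h hh
      have hb : ∀ n, |h (x (φ n))| ≤ 1 := fun n =>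
        (h.le_of_opNorm_le hh _).trans (by simpa using hx _)
      refine tendsto_of_no_upcrossings (Rat.denseRange_cast (𝕜 := ℝ)) ?_
        (isBoundedUnder_of ⟨1, fun n => (abs_le.1 (hb n)).2⟩)
        (isBoundedUnder_of ⟨-1, fun n => (abs_le.1 (hb n)).1⟩)
      rintro _ ⟨a, rfl⟩ _ ⟨b, rfl⟩ hab ⟨h1, h2⟩
      exact H (a, b) h ⟨h1.mono fun n hn => ⟨⟨by exact_mod_cast hab, hh⟩, hn⟩,
        h2.mono fun n hn => ⟨hh, hn⟩⟩
    have hpos : 0 < ‖h‖ + 1 := by positivity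
    obtain ⟨l, hl⟩ := key ((‖h‖ + 1)⁻¹ • h) (by
      rw [norm_smul, norm_inv, Real.norm_of_nonneg hpos.le, inv_mul_le_iff₀ hpos]; linarith)
    refine ⟨(‖h‖ + 1) * l, (hl.const_mul (‖h‖ + 1)).congr fun n => ?_⟩
    simp [hpos.ne']
  · exfalso
    apply hX
    obtain ⟨t, ht⟩ := H 1 fun _ => True
    have hrs : (r : ℝ) < s := by exact_mod_cast ((ht 0 one_pos).1 trivial).1.1
    refine embedsIso_lp_one (y := fun n => x (φ n)) (fun n => hx _) (c := (s - r) / 2)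
      (by linarith) fun a k => ?_
    obtain ⟨h₁, hh₁⟩ := H k fun j => a j < 0
    obtain ⟨h₂, hh₂⟩ := H k fun j => 0 ≤ a j
    rcases Nat.eq_zero_or_pos k with rfl | hk
    · simp
    have hn : ∀ h : X →L[ℝ] ℝ, ‖h‖ ≤ 1 → ∀ z, |h z| ≤ ‖z‖ := fun h hh z => by
      simpa using h.le_of_opNorm_le hh z
    have hn₁ : ‖h₁‖ ≤ 1 := by
      by_cases h0 : a 0 < 0
      exacts [((hh₁ 0 hk).1 h0).1.2, ((hh₁ 0 hk).2 h0).1]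
    have hn₂ : ‖h₂‖ ≤ 1 := by
      by_cases h0 : 0 ≤ a 0
      exacts [((hh₂ 0 hk).1 h0).1.2, ((hh₂ 0 hk).2 h0).1]
    set z := ∑ j ∈ Finset.range k, a j • x (φ j) with hz
    have hsum : (s - r) * ∑ j ∈ Finset.range k, |a j| ≤ h₁ z - h₂ z := by
      simp only [hz, map_sum, map_smul, smul_eq_mul, Finset.mul_sum, ← Finset.sum_sub_distrib]
      refine Finset.sum_le_sum fun j hj => ?_
      have hj := Finset.mem_range.1 hj
      by_cases h0 : 0 ≤ a j
      · have e₁ := ((hh₁ j hj).2 (not_lt.2 h0)).2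
        have e₂ := ((hh₂ j hj).1 h0).2
        simp only at e₁ e₂
        rw [abs_of_nonneg h0]
        nlinarith
      · have e₁ := ((hh₁ j hj).1 (not_le.1 h0)).2
        have e₂ := ((hh₂ j hj).2 h0).2
        simp only at e₁ e₂
        rw [abs_of_neg (not_le.1 h0)]
        nlinarith
    have := abs_le.1 (hn h₁ hn₁ z)
    have := abs_le.1 (hn h₂ hn₂ z)
    linarith

end Embedding

section Limsup

variable {E : Type*} [NormedAddCommGroup E]

lemma eventually_norm_add_lt {x : ℕ → E} {u v : E}
    (h : limsup (fun n => ‖x n + u‖) atTop ≤ limsup (fun n => ‖x n + v‖) atTop)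
    {R R' : ℝ} (hR : ∀ᶠ n in atTop, ‖x n + v‖ ≤ R) (hRR' : R < R') :
    ∀ᶠ n in atTop, ‖x n + u‖ < R' := by
  have hv : limsup (fun n => ‖x n + v‖) atTop ≤ R :=
    limsup_le_of_le (IsBoundedUnder.isCoboundedUnder_le
      (isBoundedUnder_of ⟨0, fun n => norm_nonneg _⟩)) hR
  refine eventually_lt_of_limsup_lt ((h.trans hv).trans_lt hRR') ⟨R + ‖u - v‖, ?_⟩
  refine eventually_map.2 (hR.mono fun n hn => ?_)
  calc ‖x n + u‖ = ‖(x n + v) + (u - v)‖ := by congr 1; abel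
    _ ≤ ‖x n + v‖ + ‖u - v‖ := norm_add_le _ _
    _ ≤ R + ‖u - v‖ := by gcongr

lemma limsup_norm_add_le {x : ℕ → E} {C : ℝ} (hx : ∀ n, ‖x n‖ ≤ C) {u v : E}
    (h : ∀ R R' : ℝ, R < R' → (∀ᶠ n in atTop, ‖x n + v‖ ≤ R) →
      ∀ᶠ n in atTop, ‖x n + u‖ < R') :
    limsup (fun n => ‖x n + u‖) atTop ≤ limsup (fun n => ‖x n + v‖) atTop := by
  refine le_of_forall_gt fun R' hR' => ?_
  obtain ⟨R, hR, hRR'⟩ := exists_between hR'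
  obtain ⟨R₁, hR₁, hRR₁⟩ := exists_between hRR'
  have hev : ∀ᶠ n in atTop, ‖x n + v‖ < R := by
    refine eventually_lt_of_limsup_lt hR (isBoundedUnder_of ⟨C + ‖v‖, fun n => ?_⟩)
    exact (norm_add_le _ _).trans (by gcongr; exact hx n)
  exact (limsup_le_of_le (IsBoundedUnder.isCoboundedUnder_le
      (isBoundedUnder_of ⟨0, fun n => norm_nonneg _⟩))
      ((h R R₁ hR₁ (hev.mono fun n hn => hn.le)).mono fun n hn => hn.le)).trans_lt hRR₁

end Limsup

section Bounded

variable {X : Type*} [NormedAddCommGroup X] [NormedSpace ℝ X]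

lemma WeakStarNull.bounded [CompleteSpace X] {f : ℕ → (X →L[ℝ] ℝ)} (hf : WeakStarNull f) :
    ∃ C, ∀ n, ‖f n‖ ≤ C := by
  refine banach_steinhaus fun x => ?_
  obtain ⟨C, hC⟩ := (Metric.isBounded_range_of_tendsto _ (hf x)).exists_norm_le
  exact ⟨C, fun n => hC _ ⟨n, rfl⟩⟩

lemma WeakNull.bounded {x : ℕ → X} (hx : WeakNull x) : ∃ C, ∀ n, ‖x n‖ ≤ C := by
  obtain ⟨C, hC⟩ := banach_steinhaus
    (g := fun n => NormedSpace.inclusionInDoubleDual ℝ X (x n)) fun h => by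
      obtain ⟨C, hC⟩ := (Metric.isBounded_range_of_tendsto _ (hx h)).exists_norm_le
      exact ⟨C, fun n => hC _ ⟨n, rfl⟩⟩
  refine ⟨C, fun n => ?_⟩
  have h := hC n
  rwa [show ‖NormedSpace.inclusionInDoubleDual ℝ X (x n)‖ = ‖x n‖ from
    (NormedSpace.inclusionInDoubleDualLi ℝ (E := X)).norm_map (x n)] at h

lemma WeakNull.comp {x : ℕ → X} (hx : WeakNull x) {φ : ℕ → ℕ} (hφ : Tendsto φ atTop atTop) :
    WeakNull fun n => x (φ n) := fun h => (hx h).comp hφ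

lemma WeakStarNull.comp {f : ℕ → (X →L[ℝ] ℝ)} (hf : WeakStarNull f) {φ : ℕ → ℕ}
    (hφ : Tendsto φ atTop atTop) : WeakStarNull fun n => f (φ n) := fun x => (hf x).comp hφ

lemma WeakNull.const_smul {x : ℕ → X} (hx : WeakNull x) (a : ℝ) :
    WeakNull fun n => a • x n := fun h => by simpa using (hx h).const_mul a

lemma WeakStarNull.const_smul {f : ℕ → (X →L[ℝ] ℝ)} (hf : WeakStarNull f) (a : ℝ) :
    WeakStarNull fun n => a • f n := fun x => by simpa using (hf x).const_mul a

lemma exists_norm_le_one_lt_apply {f : X →L[ℝ] ℝ} {r : ℝ} (hr : r < ‖f‖) :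
    ∃ x : X, ‖x‖ ≤ 1 ∧ r < f x := by
  rcases lt_or_ge r 0 with h0 | h0
  · exact ⟨0, by simp, by simpa using h0⟩
  obtain ⟨x, hx, hrx⟩ := f.exists_lt_apply_of_lt_opNorm hr
  rcases le_total 0 (f x) with h | h
  · exact ⟨x, hx.le, by rwa [Real.norm_of_nonneg h] at hrx⟩
  · exact ⟨-x, by simpa using hx.le, by rwa [Real.norm_of_nonpos h, ← map_neg] at hrx⟩

lemma exists_norm_le_lt_apply (v : X →L[ℝ] ℝ) {r ε : ℝ} (hr : 0 ≤ r) (hε : 0 < ε) :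
    ∃ w : X, ‖w‖ ≤ r ∧ ‖v‖ * r - ε ≤ v w := by
  rcases hr.eq_or_lt with rfl | hr
  · exact ⟨0, by simp, by simpa using hε.le⟩
  obtain ⟨y, hy, hvy⟩ := exists_norm_le_one_lt_apply
    (show ‖v‖ - ε / r < ‖v‖ by linarith [div_pos hε hr])
  refine ⟨r • y, ?_, ?_⟩
  · rw [norm_smul, Real.norm_of_nonneg hr.le]
    exact mul_le_of_le_one_right hr.le hy
  · rw [map_smul, smul_eq_mul]
    calc ‖v‖ * r - ε = r * (‖v‖ - ε / r) := by field_simp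
      _ ≤ r * v y := by gcongr

/-- Sequential Banach–Alaoglu. -/
lemma exists_weakStar_subseq [TopologicalSpace.SeparableSpace X] {h : ℕ → (X →L[ℝ] ℝ)} {r : ℝ}
    (hr : ∀ n, ‖h n‖ ≤ r) :
    ∃ (g : X →L[ℝ] ℝ) (φ : ℕ → ℕ), ‖g‖ ≤ r ∧ StrictMono φ ∧
      ∀ x, Tendsto (fun n => h (φ n) x) atTop (𝓝 (g x)) := by
  obtain ⟨g, hg, φ, hφ, hlim⟩ := WeakDual.isSeqCompact_closedBall ℝ X 0 r
    (x := fun n => StrongDual.toWeakDual (h n)) fun n => by simpa using hr n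
  refine ⟨WeakDual.toStrongDual g, φ, by simpa using hg, hφ, fun x => ?_⟩
  exact ((WeakDual.eval_continuous x).tendsto g).comp hlim

end Bounded

section DualToPrimal

variable {X : Type*} [NormedAddCommGroup X] [NormedSpace ℝ X]
  [TopologicalSpace.SeparableSpace X]

theorem PropertyMStar.propertyM (hM : PropertyMStar X) : PropertyM X := by
  intro x hx u v huv
  obtain ⟨C, hC⟩ := hx.bounded
  refine limsup_norm_add_le hC fun R R' hRR' hR => ?_
  by_contra hcon
  have hfr : ∃ᶠ n in atTop, R' ≤ ‖x n + u‖ := by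
    simpa only [Filter.not_eventually, not_lt] using hcon
  obtain ⟨φ, hφ, hφR⟩ := extraction_of_frequently_atTop hfr
  choose h hh1 hhn using fun n => exists_dual_vector'' ℝ (x (φ n) + u)
  obtain ⟨l, ψ, -, hψ, hl⟩ := exists_weakStar_subseq hh1
  obtain ⟨g₀, hg₀, hg₀v⟩ := exists_dual_vector'' ℝ v
  simp only [RCLike.ofReal_real_eq_id, id] at hhn hg₀v
  have hnull : WeakStarNull fun n => h (ψ n) - l := fun z => by
    simpa using (hl z).sub_const (l z)
  have hgl : ‖‖l‖ • g₀‖ ≤ ‖l‖ := by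
    rw [norm_smul, norm_norm]
    exact mul_le_of_le_one_right (norm_nonneg _) hg₀
  have hR0 : 0 ≤ R := by
    obtain ⟨n, hn⟩ := hR.exists
    exact (norm_nonneg _).trans hn
  set ε := (R' - R) / (2 * (R + 1)) with hε
  have hεpos : 0 < ε := div_pos (by linarith) (by linarith)
  have hεR : ε * (R + 1) = (R' - R) / 2 := by rw [hε]; field_simp
  have hev := eventually_norm_add_lt (hM _ hnull _ _ hgl) (R := 1) (R' := 1 + ε)
    (Eventually.of_forall fun n => by simpa using hh1 (ψ n)) (by linarith)
  have hsub : Tendsto (fun n => φ (ψ n)) atTop atTop :=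
    hφ.tendsto_atTop.comp hψ.tendsto_atTop
  have hlim : Tendsto (fun n => R' - h (ψ n) u - l (x (φ (ψ n))) + (h (ψ n) - l) v
      + ‖l‖ * g₀ (x (φ (ψ n))) + ‖l‖ * ‖v‖) atTop
      (𝓝 (R' - l u - 0 + 0 + ‖l‖ * 0 + ‖l‖ * ‖v‖)) :=
    ((((tendsto_const_nhds.sub (hl u)).sub (hx.comp hsub l)).add (hnull v)).add
      ((hx.comp hsub g₀).const_mul _)).add tendsto_const_nhds
  have hle : R' - l u - 0 + 0 + ‖l‖ * 0 + ‖l‖ * ‖v‖ ≤ (1 + ε) * R := by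
    refine le_of_tendsto hlim ?_
    filter_upwards [hev, hsub.eventually hR] with n hn hnR
    have e1 := (h (ψ n) - l + ‖l‖ • g₀).le_of_opNorm_le_of_le hn.le hnR
    have e2 := (le_abs_self _).trans e1
    simp only [add_apply, sub_apply,
      smul_apply, smul_eq_mul, map_add, hg₀v] at e2 ⊢
    have e3 := hhn (ψ n)
    have e4 := hφR (ψ n)
    rw [← e3, map_add] at e4
    linarith
  have hlu : l u ≤ ‖l‖ * ‖v‖ :=
    ((le_abs_self _).trans (l.le_opNorm u)).trans (by gcongr)
  nlinarith

/-- Under (M*) the dual norm has the weak* Kadec–Klee property. -/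
theorem PropertyMStar.kadecKlee (hM : PropertyMStar X) {f : X →L[ℝ] ℝ} {g : ℕ → (X →L[ℝ] ℝ)}
    (hg : WeakStarNull g) (hlim : Tendsto (fun n => ‖f + g n‖) atTop (𝓝 ‖f‖)) {δ : ℝ}
    (hδ : 0 < δ) (hgδ : ∀ n, δ ≤ ‖g n‖) : False := by
  set r := ‖f‖ with hr
  have hr0 : 0 < r := by
    rcases (norm_nonneg f).eq_or_lt with h0 | h0
    · have hf : f = 0 := norm_eq_zero.1 h0.symm
      subst hf
      simp only [zero_add] at hlim
      have := ge_of_tendsto' hlim hgδ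
      linarith
    · exact h0
  obtain ⟨a, hflat, hnflat⟩ : ∃ a : ℝ,
      (∀ R', r < R' → ∀ᶠ n in atTop, ‖f + a • g n‖ < R') ∧
      ¬ ∀ R', r < R' → ∀ᶠ n in atTop, ‖f + (2 * a) • g n‖ < R' := by
    by_contra! hcon
    have hall : ∀ j : ℕ, ∀ R', r < R' → ∀ᶠ n in atTop, ‖f + (2 ^ j : ℝ) • g n‖ < R' := by
      intro j
      induction j with
      | zero => intro R' hR'; simpa using hlim.eventually_lt_const hR'
      | succ j ih => rw [pow_succ']; exact hcon _ ih
    obtain ⟨j, hj⟩ := pow_unbounded_of_one_lt ((2 * r + 1) / δ) (one_lt_two (α := ℝ))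
    obtain ⟨n, hn⟩ := (hall j (r + 1) (by linarith)).exists
    rw [div_lt_iff₀ hδ] at hj
    have h1 : ‖(2 ^ j : ℝ) • g n‖ ≤ ‖f + (2 ^ j : ℝ) • g n‖ + ‖f‖ := by
      simpa using norm_sub_le (f + (2 ^ j : ℝ) • g n) f
    have h2 : ‖(2 ^ j : ℝ) • g n‖ = 2 ^ j * ‖g n‖ := by
      rw [norm_smul, Real.norm_of_nonneg (by positivity)]
    have h3 : (2 : ℝ) ^ j * δ ≤ 2 ^ j * ‖g n‖ := by gcongr; exact hgδ n
    linarith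
  push Not at hnflat
  obtain ⟨R₀, hrR₀, hR₀⟩ := hnflat
  set G := fun n => a • g n with hG
  have hGnull : WeakStarNull G := hg.const_smul a
  have hG2 : WeakStarNull fun n => (2 * a) • g n := hg.const_smul _
  have F1 : ∀ (v : X →L[ℝ] ℝ) (R : ℝ), r < R → ‖v‖ < R → ∀ᶠ n in atTop, ‖v + G n‖ < R := by
    intro v R hrR hvR
    rcases le_total ‖v‖ r with hv | hv
    · obtain ⟨R₁, h1, h2⟩ := exists_between hrR
      simpa only [add_comm] using eventually_norm_add_lt (hM _ hGnull v f hv)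
        ((hflat R₁ h1).mono fun n hn => by rw [add_comm]; exact hn.le) h2
    · obtain ⟨R₁, h1, h2⟩ := exists_between hvR
      have hs : ‖(‖v‖ / r) • f‖ = ‖v‖ := by
        rw [norm_smul, Real.norm_of_nonneg (by positivity), ← hr]; field_simp
      have hs' : ‖(‖v‖ / r) • f - f‖ = ‖v‖ - r := by
        have : 1 ≤ ‖v‖ / r := (one_le_div hr0).2 hv
        rw [show (‖v‖ / r) • f - f = (‖v‖ / r - 1) • f by module, norm_smul,
          Real.norm_of_nonneg (by linarith), ← hr]
        field_simp
      simpa only [add_comm] using eventually_norm_add_lt (hM _ hGnull v ((‖v‖ / r) • f) hs.ge)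
        (R := R₁) ((hflat (r + (R₁ - ‖v‖)) (by linarith)).mono fun n hn => by
          calc ‖G n + (‖v‖ / r) • f‖ = ‖(f + a • g n) + ((‖v‖ / r) • f - f)‖ := by
                congr 1; simp only [hG]; abel
            _ ≤ ‖f + a • g n‖ + ‖(‖v‖ / r) • f - f‖ := norm_add_le _ _
            _ ≤ R₁ := by rw [hs']; linarith) h2
  have F2 : ∀ (v : X →L[ℝ] ℝ) (R : ℝ), r ≤ ‖v‖ → R < R₀ →
      ∃ᶠ n in atTop, R < ‖v + (2 * a) • g n‖ := by
    intro v R hv hR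
    by_contra hcon
    rw [not_frequently] at hcon
    have := eventually_norm_add_lt (hM _ hG2 f v hv)
      (hcon.mono fun n hn => by rw [add_comm]; exact not_lt.1 hn) hR
    obtain ⟨n, hn, hn'⟩ := (hR₀.and_eventually this).exists
    rw [add_comm] at hn'
    linarith
  obtain ⟨m, hrm, hmR⟩ := exists_between hrR₀
  obtain ⟨s, hrs, hsm⟩ := exists_between hrm
  obtain ⟨p₀, hp₀, hp₀'⟩ : ∃ p₀ : X →L[ℝ] ℝ, r < ‖p₀‖ ∧ ‖p₀‖ < s := by
    obtain ⟨q, h1, h2⟩ := exists_between hrs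
    have : ‖(q / r) • f‖ = q := by
      rw [norm_smul, Real.norm_of_nonneg (div_nonneg (by linarith) hr0.le), ← hr]; field_simp
    exact ⟨(q / r) • f, by rwa [this], by rwa [this]⟩
  obtain ⟨x₀, hx₀, hpx₀⟩ := exists_norm_le_one_lt_apply hp₀
  let S := {σ : (X →L[ℝ] ℝ) × Set (X × ℝ) // ‖σ.1‖ < s ∧ σ.2.Finite ∧ (x₀, r) ∈ σ.2 ∧
    ∀ c ∈ σ.2, c.2 < σ.1 c.1}
  have step : ∀ (i : ℕ) (σ : S), ∃ (n : ℕ) (y : X) (τ : S), i ≤ n ∧ ‖y‖ ≤ 1 ∧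
      σ.1.2 ⊆ τ.1.2 ∧ (y, m - G n y) ∈ τ.1.2 := by
    rintro i ⟨⟨p, W⟩, hp, hfin, hmem, hW⟩
    simp only at hp hfin hmem hW
    have hrp : r ≤ ‖p‖ :=
      (hW _ hmem).le.trans (((le_abs_self _).trans (p.le_opNorm _)).trans
        (mul_le_of_le_one_right (norm_nonneg _) hx₀))
    have hWev : ∀ᶠ n in atTop, ∀ c ∈ W, c.2 < (p + G n) c.1 := by
      rw [eventually_all_finite hfin]
      intro c hc
      have : Tendsto (fun n => (p + G n) c.1) atTop (𝓝 (p c.1 + 0)) :=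
        tendsto_const_nhds.add (hGnull c.1)
      rw [add_zero] at this
      exact this.eventually_const_lt (hW c hc)
    obtain ⟨n, hn, ⟨hnW, hns⟩, hni⟩ := ((F2 p m hrp hmR).and_eventually
      ((hWev.and (F1 p s hrs hp)).and (eventually_ge_atTop i))).exists
    obtain ⟨y, hy, hmy⟩ := exists_norm_le_one_lt_apply hn
    refine ⟨n, y, ⟨(p + G n, insert (y, m - G n y) W), hns, hfin.insert _,
      Set.mem_insert_of_mem _ hmem, ?_⟩, hni, hy, Set.subset_insert _ _, Set.mem_insert _ _⟩
    rintro c (rfl | hc)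
    · simp only [hG, add_apply, smul_apply,
        smul_eq_mul] at hmy ⊢
      linarith
    · exact hnW c hc
  choose N Y nxt hN hY hmono hmem using step
  let σ₀ : S := ⟨(p₀, {(x₀, r)}), hp₀', Set.finite_singleton _, rfl, by
    rintro c rfl; exact hpx₀⟩
  let σ : ℕ → S := fun i => Nat.rec σ₀ nxt i
  have hσ : Monotone fun i => (σ i).1.2 := monotone_nat_of_le_succ fun i => hmono i (σ i)
  obtain ⟨P, φ, hP, hφ, hφlim⟩ := exists_weakStar_subseq (h := fun i => (σ i).1.1)
    fun i => (σ i).2.1.le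
  obtain ⟨i₀, hi₀⟩ := eventually_atTop.1 (F1 P m hrm (hP.trans_lt hsm))
  have h1 := hi₀ (N i₀ (σ i₀)) (hN _ _)
  have h2 : m - G (N i₀ (σ i₀)) (Y i₀ (σ i₀)) ≤ P (Y i₀ (σ i₀)) := by
    refine ge_of_tendsto (hφlim _) ((eventually_ge_atTop (i₀ + 1)).mono fun j hj => ?_)
    exact ((σ (φ j)).2.2.2.2 _ (hσ (hj.trans (hφ.id_le j)) (hmem i₀ (σ i₀)))).le
  have h4 : ‖P + G (N i₀ (σ i₀))‖ < m := h1
  have h5 := (le_abs_self _).trans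
    ((P + G (N i₀ (σ i₀))).le_of_opNorm_le_of_le le_rfl (hY i₀ (σ i₀)))
  simp only [add_apply] at h5
  linarith

end DualToPrimal

section NoLpOne

/-- An uncountable family in a second countable space accumulates at one of its members. -/
lemma exists_seq_ne_tendsto {A Y : Type*} [Uncountable A] [TopologicalSpace Y]
    [SecondCountableTopology Y] (Φ : A → Y) :
    ∃ (α : A) (s : ℕ → A), (∀ n, s n ≠ α) ∧ Tendsto (fun n => Φ (s n)) atTop (𝓝 (Φ α)) := by
  let _ : TopologicalSpace A := TopologicalSpace.induced Φ inferInstance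
  have : SecondCountableTopology A := TopologicalSpace.secondCountableTopology_induced A Y Φ
  have hcont : Continuous Φ := continuous_induced_dom
  by_contra! hcon
  have hdisc : DiscreteTopology A := by
    refine discreteTopology_iff_nhds_ne.2 fun α => ?_
    by_contra hne
    have : NeBot (𝓝[≠] α) := ⟨hne⟩
    obtain ⟨s, hs⟩ := exists_seq_tendsto (𝓝[≠] α)
    obtain ⟨hs1, hs2⟩ := tendsto_nhdsWithin_iff.1 hs
    obtain ⟨N, hN⟩ := eventually_atTop.1 hs2
    exact hcon α (fun n => s (n + N)) (fun n => hN _ (by omega))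
      (((hcont.tendsto α).comp hs1).comp (tendsto_add_atTop_nat N))
  have : Countable A := countable_of_Lindelof_of_discrete
  exact not_countable this

variable {X : Type*} [NormedAddCommGroup X] [NormedSpace ℝ X]

/-- Prescribed signs on a copy of the `ℓ₁` basis are realised by a functional. -/
lemma exists_functional_sign {T : lp (fun _ : ℕ => ℝ) 1 →L[ℝ] X} (hT : Function.Injective T)
    {c : ℝ} (hc : 0 < c) (hlow : ∀ y, c * ‖y‖ ≤ ‖T y‖) {b : ℕ → ℝ} (hb : ∀ n, |b n| ≤ 1) :
    ∃ h : X →L[ℝ] ℝ, ∀ n, h (T (lp.single 1 n 1)) = b n := by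
  have hle : ∀ (a : lp (fun _ : ℕ => ℝ) 1) (n : ℕ), ‖b n * a n‖ ≤ |a n| := fun a n => by
    rw [norm_mul, Real.norm_eq_abs, Real.norm_eq_abs]
    exact mul_le_of_le_one_left (abs_nonneg _) (hb n)
  have hsum : ∀ a : lp (fun _ : ℕ => ℝ) 1, Summable fun n => b n * a n := fun a =>
    Summable.of_norm_bounded (lp_one_summable a) (hle a)
  let ℓ : lp (fun _ : ℕ => ℝ) 1 →ₗ[ℝ] ℝ :=
    { toFun := fun a => ∑' n, b n * a n
      map_add' := fun u v => by
        rw [← (hsum u).tsum_add (hsum v)]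
        simp [mul_add]
      map_smul' := fun r a => by
        simp only [RingHom.id_apply, smul_eq_mul]
        rw [← tsum_mul_left]
        congr 1 with n
        simp only [lp.coeFn_smul, Pi.smul_apply, smul_eq_mul]
        ring }
  have hℓ : ∀ a, ‖ℓ a‖ ≤ ‖a‖ := fun a => by
    rw [lp_one_norm]
    exact tsum_of_norm_bounded (lp_one_summable a).hasSum (hle a)
  let e := LinearEquiv.ofInjective (T : lp (fun _ : ℕ => ℝ) 1 →ₗ[ℝ] X) hT
  have he : ∀ a, (e a : X) = T a := fun a => rfl
  let q := (ℓ ∘ₗ e.symm.toLinearMap).mkContinuous c⁻¹ fun z => by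
    obtain ⟨a, rfl⟩ := e.surjective z
    have h2 : c * ‖a‖ ≤ ‖e a‖ := hlow a
    have h3 := hℓ a
    rw [LinearMap.comp_apply, LinearEquiv.coe_coe, LinearEquiv.symm_apply_apply]
    rw [inv_mul_eq_div, le_div_iff₀ hc]
    nlinarith
  obtain ⟨h, hh, -⟩ := exists_extension_norm_eq _ q
  refine ⟨h, fun n => ?_⟩
  have h1 := hh (e (lp.single 1 n 1))
  rw [he] at h1
  rw [h1]
  change ℓ (e.symm (e _)) = _
  rw [LinearEquiv.symm_apply_apply]
  change ∑' k, b k * (lp.single 1 n (1 : ℝ) : lp (fun _ : ℕ => ℝ) 1) k = b n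
  rw [tsum_eq_single n fun k hk => by simp [hk]]
  simp

theorem PropertyMStar.not_embedsIso [TopologicalSpace.SeparableSpace X]
    (hM : PropertyMStar X) : ¬ EmbedsIso (lp (fun _ : ℕ => ℝ) 1) X := by
  rintro ⟨T, hT, c, hc, hlow⟩
  have hsign : ∀ α : ℕ → Bool, ∃ h : X →L[ℝ] ℝ,
      ∀ n, h (T (lp.single 1 n 1)) = if α n then 1 else -1 := fun α =>
    exists_functional_sign hT hc hlow fun n => by split_ifs <;> simp
  choose h hh using hsign
  set D := ‖T‖ + 1 with hD
  have hDpos : 0 < D := by positivity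
  have hsep : ∀ α β, α ≠ β → 2 / D ≤ ‖h α - h β‖ := by
    intro α β hαβ
    obtain ⟨n, hn⟩ := Function.ne_iff.1 hαβ
    set e : lp (fun _ : ℕ => ℝ) 1 := lp.single 1 n 1 with he
    have hTe : ‖T e‖ ≤ D := by
      have h1 : ‖e‖ = 1 := by simp [he, lp.norm_single]
      have h2 := T.le_opNorm e
      rw [h1] at h2
      linarith
    have h2 : |(h α - h β) (T e)| = 2 := by
      rw [sub_apply, hh, hh]
      cases hα : α n <;> cases hβ : β n <;> simp_all <;> norm_num
    rw [div_le_iff₀ hDpos, ← h2]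
    exact ((h α - h β).le_opNorm _).trans (by gcongr)
  have : Uncountable (ℕ → Bool) := by
    rw [← Cardinal.aleph0_lt_mk_iff]
    simpa using Cardinal.cantor Cardinal.aleph0
  obtain ⟨α, s, hs, hlim⟩ := exists_seq_ne_tendsto
    fun α : ℕ → Bool => (fun k => h α (TopologicalSpace.denseSeq X k), ‖h α‖)
  rw [Prod.tendsto_iff] at hlim
  obtain ⟨hlim₁, hlim₂⟩ := hlim
  rw [tendsto_pi_nhds] at hlim₁
  simp only at hlim₁ hlim₂
  obtain ⟨C, hC⟩ := (Metric.isBounded_range_of_tendsto _ hlim₂).exists_norm_le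
  have hC' : ∀ n, ‖h (s n) - h α‖ ≤ C + ‖h α‖ := fun n =>
    (norm_sub_le _ _).trans (by gcongr; simpa using hC _ ⟨n, rfl⟩)
  have hnull : WeakStarNull fun n => h (s n) - h α := by
    intro x
    rw [Metric.tendsto_atTop]
    intro ε hε
    have hB : 0 < C + ‖h α‖ + 1 := by linarith [norm_nonneg (h (s 0) - h α), hC' 0]
    obtain ⟨k, hk⟩ := (TopologicalSpace.denseRange_denseSeq X).exists_dist_lt x
      (show 0 < ε / 2 / (C + ‖h α‖ + 1) by positivity)
    rw [lt_div_iff₀ hB, dist_eq_norm] at hk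
    obtain ⟨N, hN⟩ := Metric.tendsto_atTop.1 (hlim₁ k) (ε / 2) (by positivity)
    refine ⟨N, fun n hn => ?_⟩
    have h1 := hN n hn
    have h2 := (h (s n) - h α).le_of_opNorm_le (hC' n) (x - TopologicalSpace.denseSeq X k)
    rw [Real.dist_eq] at h1 ⊢
    rw [sub_zero]
    have h3 : (h (s n) - h α) x = (h (s n) - h α) (x - TopologicalSpace.denseSeq X k)
        + (h (s n) (TopologicalSpace.denseSeq X k) - h α (TopologicalSpace.denseSeq X k)) := by
      simp only [sub_apply, map_sub]
      ring
    rw [h3]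
    refine (abs_add_le _ _).trans_lt ?_
    rw [Real.norm_eq_abs] at h2
    nlinarith [norm_nonneg (x - TopologicalSpace.denseSeq X k)]
  exact hM.kadecKlee (f := h α) hnull (by simpa using hlim₂) (div_pos two_pos hDpos)
    fun n => hsep _ _ (hs n)

end NoLpOne

section PrimalToDual

variable {X : Type*} [NormedAddCommGroup X] [NormedSpace ℝ X]

/-- `e` has the same scalar limits as `x`. -/
def SameWeakLimits (e x : ℕ → X) : Prop :=
  ∀ (h : X →L[ℝ] ℝ) (l : ℝ), Tendsto (fun n => h (x n)) atTop (𝓝 l) →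
    Tendsto (fun n => h (e n)) atTop (𝓝 l)

/-- A sequence all of whose scalar images converge. -/
def WeakCauchy (x : ℕ → X) : Prop :=
  ∀ h : X →L[ℝ] ℝ, ∃ l, Tendsto (fun n => h (x n)) atTop (𝓝 l)

lemma WeakCauchy.weakNull_sub {x : ℕ → X} (hx : WeakCauchy x) {k q : ℕ → ℕ}
    (hk : Tendsto k atTop atTop) (hq : Tendsto q atTop atTop) :
    WeakNull fun i => x (k i) - x (q i) := fun h => by
  obtain ⟨l, hl⟩ := hx h
  simpa using (hl.comp hk).sub (hl.comp hq)

/-- Differences of a weakly Cauchy sequence cannot uniformly lengthen all vectors. -/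
lemma WeakCauchy.exists_norm_add_lt [CompleteSpace X] {x : ℕ → X} (hx : WeakCauchy x)
    (hx1 : ∀ n, ‖x n‖ ≤ 1) {κ : ℝ} (hκ : 0 < κ) :
    ∃ (z : X) (a : ℝ), 0 < a ∧ ∃ N, ∀ k ≥ N, ∀ q ≥ N,
      ‖z + a • (x k - x q)‖ < ‖z‖ + κ * a := by
  by_contra! hcon
  set ρ := min (1 / 2) (κ / 16) with hρ
  have hρ0 : 0 < ρ := lt_min (by norm_num) (by positivity)
  have hρ1 : ρ ≤ 1 / 2 := min_le_left _ _
  have hρ2 : ρ ≤ κ / 16 := min_le_right _ _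
  choose! k hk q hq hkq using hcon
  let Z : ℕ → X := fun r => Nat.rec 0
    (fun r z => z + ρ ^ r • (x (k z (ρ ^ r) r) - x (q z (ρ ^ r) r))) r
  set K := fun r => k (Z r) (ρ ^ r) r with hK
  set Q := fun r => q (Z r) (ρ ^ r) r with hQ
  have hpow : ∀ r : ℕ, 0 < ρ ^ r := fun r => pow_pos hρ0 r
  have hZ : ∀ r, Z (r + 1) = Z r + ρ ^ r • (x (K r) - x (Q r)) := fun r => rfl
  have hgrow : ∀ r, ‖Z r‖ + κ * ρ ^ r ≤ ‖Z (r + 1)‖ := fun r => by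
    rw [hZ]; exact hkq (Z r) (ρ ^ r) (hpow r) r
  have hdist : ∀ r, dist (Z r) (Z (r + 1)) ≤ 2 * ρ ^ r := fun r => by
    rw [dist_comm, dist_eq_norm, hZ, add_sub_cancel_left, norm_smul,
      Real.norm_of_nonneg (hpow r).le, mul_comm]
    have := norm_sub_le (x (K r)) (x (Q r))
    have := hx1 (K r)
    have := hx1 (Q r)
    exact mul_le_mul_of_nonneg_right (by linarith) (hpow r).le
  obtain ⟨z, hz⟩ := cauchySeq_tendsto_of_complete
    (cauchySeq_of_le_geometric ρ 2 (by linarith) hdist)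
  have htail : ∀ r, ‖Z (r + 1) - z‖ ≤ 4 * ρ * ρ ^ r := fun r => by
    have h := dist_le_of_le_geometric_of_tendsto ρ 2 (by linarith) hdist hz (r + 1)
    rw [dist_eq_norm] at h
    refine h.trans ?_
    rw [div_le_iff₀ (by linarith), pow_succ]
    nlinarith [mul_pos hρ0 (hpow r)]
  obtain ⟨h, hh1, hhz⟩ := exists_dual_vector'' ℝ z
  simp only [RCLike.ofReal_real_eq_id, id] at hhz
  have hhle : ∀ y, |h y| ≤ ‖y‖ := fun y => by simpa using h.le_of_opNorm_le hh1 y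
  have hlow : ∀ r, κ / 2 ≤ h (x (K r) - x (Q r)) := fun r => by
    have h1 : h (Z (r + 1)) = h (Z r) + ρ ^ r * h (x (K r) - x (Q r)) := by
      rw [hZ, map_add, map_smul, smul_eq_mul]
    have h2 := (abs_le.1 ((hhle (Z (r + 1) - z)).trans (htail r))).1
    rw [map_sub, hhz] at h2
    have h3 := (abs_le.1 (hhle (Z r))).2
    have h4 := norm_le_norm_add_norm_sub' (Z (r + 1)) z
    have h5 := hgrow r
    have h6 := htail r
    have h7 : 0 ≤ ρ ^ r * (h (x (K r) - x (Q r)) - κ / 2) := by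
      nlinarith [mul_le_mul_of_nonneg_right hρ2 (hpow r).le]
    have h8 := nonneg_of_mul_nonneg_right h7 (hpow r)
    linarith
  have hKt : Tendsto K atTop atTop :=
    tendsto_atTop_mono (fun r => hk (Z r) (ρ ^ r) (hpow r) r) tendsto_id
  have hQt : Tendsto Q atTop atTop :=
    tendsto_atTop_mono (fun r => hq (Z r) (ρ ^ r) (hpow r) r) tendsto_id
  have := ge_of_tendsto' (hx.weakNull_sub hKt hQt h) hlow
  linarith

lemma exists_norm_eq_norm_sub_eq {z : X} {t : ℝ} (ht : 0 ≤ t) (htz : t ≤ ‖z‖) :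
    ∃ w : X, ‖w‖ = t ∧ ‖z - w‖ = ‖z‖ - t := by
  rcases (norm_nonneg z).eq_or_lt with h0 | h0
  · have : t = 0 := by linarith
    exact ⟨0, by simp [this], by simp [this]⟩
  refine ⟨(t / ‖z‖) • z, ?_, ?_⟩
  · rw [norm_smul, Real.norm_of_nonneg (by positivity)]; field_simp
  · have : t / ‖z‖ ≤ 1 := (div_le_one h0).2 htz
    rw [show z - (t / ‖z‖) • z = (1 - t / ‖z‖) • z by module, norm_smul,
      Real.norm_of_nonneg (by linarith)]
    field_simp

/-- Under (M), differences of a weakly Cauchy sequence hardly lengthen long vectors. -/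
lemma PropertyM.exists_norm_add_le [CompleteSpace X] (hM : PropertyM X) {x : ℕ → X}
    (hx : WeakCauchy x) (hx1 : ∀ n, ‖x n‖ ≤ 1) {κ : ℝ} (hκ : 0 < κ) :
    ∃ t > 0, ∀ z : X, t ≤ ‖z‖ → ∃ N, ∀ k ≥ N, ∀ q ≥ N,
      ‖z + (x k - x q)‖ ≤ ‖z‖ + κ := by
  obtain ⟨z₀, a, ha, N₀, hN₀⟩ := hx.exists_norm_add_lt hx1 (half_pos hκ)
  set z₁ := a⁻¹ • z₀ with hz₁
  have hN₁ : ∀ k ≥ N₀, ∀ q ≥ N₀, ‖z₁ + (x k - x q)‖ ≤ ‖z₁‖ + κ / 2 := fun k hk q hq => by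
    have h1 := hN₀ k hk q hq
    rw [show z₁ + (x k - x q) = a⁻¹ • (z₀ + a • (x k - x q)) by
        rw [smul_add, smul_smul, inv_mul_cancel₀ ha.ne', one_smul], hz₁, norm_smul, norm_smul,
      Real.norm_of_nonneg (inv_nonneg.2 ha.le), inv_mul_le_iff₀ ha]
    field_simp
    linarith
  refine ⟨max ‖z₁‖ 1, by positivity, fun z hz => ?_⟩
  by_contra! hcon
  choose k hk q hq hkq using hcon
  have hkt : Tendsto k atTop atTop := tendsto_atTop_mono hk tendsto_id
  have hqt : Tendsto q atTop atTop := tendsto_atTop_mono hq tendsto_id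
  obtain ⟨w, hw, hzw⟩ := exists_norm_eq_norm_sub_eq (norm_nonneg z₁) ((le_max_left _ _).trans hz)
  have hev := eventually_norm_add_lt (hM _ (hx.weakNull_sub hkt hqt) w z₁ hw.le)
    (R := ‖z₁‖ + κ / 2) (R' := ‖z₁‖ + κ) ((eventually_ge_atTop N₀).mono fun i hi => by
      rw [add_comm]; exact hN₁ _ (hi.trans (hk i)) _ (hi.trans (hq i))) (by linarith)
  obtain ⟨i, hi⟩ := hev.exists
  have h1 := hkq i
  have h2 : ‖z + (x (k i) - x (q i))‖ ≤ ‖x (k i) - x (q i) + w‖ + ‖z - w‖ := by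
    calc _ = ‖(x (k i) - x (q i) + w) + (z - w)‖ := by congr 1; abel
      _ ≤ _ := norm_add_le _ _
  linarith

/-- Iterated form of (M). -/
lemma PropertyM.eventually_eventually_le (hM : PropertyM X) {x e : ℕ → X} (hx : WeakCauchy x)
    (he : SameWeakLimits e x) {z₁ z₂ : X} (hz : ‖z₁‖ ≤ ‖z₂‖) {R R' : ℝ} (hRR' : R < R')
    (hR : ∀ᶠ m in atTop, ∀ᶠ n in atTop, ‖z₂ + (x n - e m)‖ ≤ R) :
    ∀ᶠ m in atTop, ∀ᶠ n in atTop, ‖z₁ + (x n - e m)‖ ≤ R' := by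
  by_contra hcon
  rw [not_eventually] at hcon
  have hpick : ∀ i : ℕ, ∃ m n, i ≤ m ∧ i ≤ n ∧ R' < ‖z₁ + (x n - e m)‖ ∧
      ‖z₂ + (x n - e m)‖ ≤ R := fun i => by
    obtain ⟨m, hm, hm', him⟩ := (hcon.and_eventually (hR.and (eventually_ge_atTop i))).exists
    rw [not_eventually] at hm
    obtain ⟨n, hn, hn', hin⟩ := (hm.and_eventually (hm'.and (eventually_ge_atTop i))).exists
    exact ⟨m, n, him, hin, not_le.1 hn, hn'⟩
  choose m n hm hn h1 h2 using hpick
  have hmt : Tendsto m atTop atTop := tendsto_atTop_mono hm tendsto_id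
  have hnt : Tendsto n atTop atTop := tendsto_atTop_mono hn tendsto_id
  have hnull : WeakNull fun i => x (n i) - e (m i) := fun h => by
    obtain ⟨l, hl⟩ := hx h
    simpa using (hl.comp hnt).sub ((he h l hl).comp hmt)
  obtain ⟨i, hi⟩ := (eventually_norm_add_lt (hM _ hnull z₁ z₂ hz)
    (Eventually.of_forall fun i => by rw [add_comm]; exact h2 i) hRR').exists
  rw [add_comm] at hi
  exact (hi.trans (h1 i)).false

end PrimalToDual

section BlockCentres

variable {X : Type*} [NormedAddCommGroup X] [NormedSpace ℝ X]

/-- The radii attained by iterated limits around a centre in the half-space `β ≤ g`. -/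
def AdmissibleRadius (x : ℕ → X) (g : X →L[ℝ] ℝ) (β R : ℝ) : Prop :=
  ∃ (c : X) (e : ℕ → X), β ≤ g c ∧ SameWeakLimits e x ∧
    ∀ᶠ m in atTop, ∀ᶠ n in atTop, ‖c + (x n - e m)‖ ≤ R

lemma AdmissibleRadius.nonneg {x : ℕ → X} {g : X →L[ℝ] ℝ} {β R : ℝ}
    (h : AdmissibleRadius x g β R) : 0 ≤ R := by
  obtain ⟨c, e, -, -, h⟩ := h
  obtain ⟨m, hm⟩ := h.exists
  obtain ⟨n, hn⟩ := hm.exists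
  exact (norm_nonneg _).trans hn

variable [CompleteSpace X]

lemma AdmissibleRadius.average (hM : PropertyM X) {x : ℕ → X} (hx : WeakCauchy x)
    (hx1 : ∀ n, ‖x n‖ ≤ 1) {g : X →L[ℝ] ℝ} {β : ℝ} (hβ : 0 < β)
    (hg : ∀ᶠ n in atTop, β ≤ g (x n)) {κ : ℝ} (hκ : 0 < κ) :
    ∃ μ > 0, ∀ R, AdmissibleRadius x g β R →
      AdmissibleRadius x g β ((R + 2 * κ * μ + μ) / (1 + μ)) := by
  obtain ⟨t, ht, htN⟩ := hM.exists_norm_add_le hx hx1 hκ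
  have hg1 : 0 < ‖g‖ + 1 := by positivity
  set μ := β / ((‖g‖ + 1) * t) with hμ
  have hμ0 : 0 < μ := by positivity
  refine ⟨μ, hμ0, ?_⟩
  rintro R ⟨c, e, hgc, he, hR⟩
  have hct : μ * t ≤ ‖c‖ := by
    have h1 : g c ≤ ‖g‖ * ‖c‖ := (le_abs_self _).trans (g.le_opNorm c)
    have h2 : μ * t * (‖g‖ + 1) = β := by rw [hμ]; field_simp
    by_contra! hlt
    nlinarith [norm_nonneg c]
  obtain ⟨N, hN⟩ := htN (μ⁻¹ • c) (by
    rw [norm_smul, norm_inv, Real.norm_of_nonneg hμ0.le, le_inv_mul_iff₀ hμ0]; exact hct)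
  obtain ⟨k, hk, hkN⟩ := (hg.and (eventually_ge_atTop N)).exists
  have hw : ∀ q ≥ N, ‖c + μ • (x k - x q)‖ ≤ ‖c‖ + κ * μ := fun q hq => by
    have h1 := hN k hkN q hq
    have h2 : c + μ • (x k - x q) = μ • (μ⁻¹ • c + (x k - x q)) := by
      rw [smul_add, smul_smul, mul_inv_cancel₀ hμ0.ne', one_smul]
    have h3 : ‖μ⁻¹ • c‖ = μ⁻¹ * ‖c‖ := by
      rw [norm_smul, norm_inv, Real.norm_of_nonneg hμ0.le]
    rw [h2, norm_smul, Real.norm_of_nonneg hμ0.le]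
    rw [h3] at h1
    calc _ ≤ μ * (μ⁻¹ * ‖c‖ + κ) := by gcongr
      _ = _ := by field_simp
  have hiter : ∀ q ≥ N, ∀ᶠ m in atTop, ∀ᶠ n in atTop,
      ‖(c + μ • (x k - x q)) + (x n - e m)‖ ≤ R + 2 * κ * μ := fun q hq => by
    obtain ⟨w, hwc, hww⟩ : ∃ w : X, ‖w‖ ≤ ‖c‖ ∧ ‖c + μ • (x k - x q) - w‖ ≤ κ * μ := by
      rcases le_total ‖c + μ • (x k - x q)‖ ‖c‖ with h | h
      · exact ⟨_, h, by rw [sub_self, norm_zero]; positivity⟩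
      · obtain ⟨w, h1, h2⟩ := exists_norm_eq_norm_sub_eq (norm_nonneg c) h
        exact ⟨w, h1.le, by rw [h2]; linarith [hw q hq]⟩
    refine (hM.eventually_eventually_le hx he hwc
      (show R < R + κ * μ by linarith [mul_pos hκ hμ0]) hR).mono fun m hm => hm.mono fun n hn => ?_
    calc _ = ‖(w + (x n - e m)) + (c + μ • (x k - x q) - w)‖ := by congr 1; abel
      _ ≤ ‖w + (x n - e m)‖ + ‖c + μ • (x k - x q) - w‖ := norm_add_le _ _
      _ ≤ _ := by linarith
  have hpick : ∀ i : ℕ, ∃ m, i ≤ m ∧ ∀ᶠ n in atTop,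
      ‖(c + μ • (x k - x (max N i))) + (x n - e m)‖ ≤ R + 2 * κ * μ := fun i => by
    obtain ⟨m, hm, him⟩ := ((hiter _ (le_max_left N i)).and (eventually_ge_atTop i)).exists
    exact ⟨m, him, hm⟩
  choose m hm hmn using hpick
  have hmt : Tendsto m atTop atTop := tendsto_atTop_mono hm tendsto_id
  have hqt : Tendsto (fun i => max N i) atTop atTop :=
    tendsto_atTop_mono (fun i => le_max_right N i) tendsto_id
  have hμ1 : 0 < 1 + μ := by linarith
  refine ⟨(1 + μ)⁻¹ • (c + μ • x k), fun i => (1 + μ)⁻¹ • (e (m i) + μ • x (max N i)),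
    ?_, ?_, Eventually.of_forall fun i => (hmn i).mono fun n hn => ?_⟩
  · rw [map_smul, map_add, map_smul, smul_eq_mul, smul_eq_mul, le_inv_mul_iff₀ hμ1]
    nlinarith
  · intro h l hl
    have h1 := ((((he h l hl).comp hmt).add ((hl.comp hqt).const_mul μ)).const_mul (1 + μ)⁻¹)
    rw [show (1 + μ)⁻¹ * (l + μ * l) = l by field_simp] at h1
    simpa [mul_add] using h1
  · have h1 : (1 + μ)⁻¹ • (c + μ • x k) + (x n - (1 + μ)⁻¹ • (e (m i) + μ • x (max N i)))
        = (1 + μ)⁻¹ • (((c + μ • (x k - x (max N i))) + (x n - e (m i))) + μ • x n) := by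
      have h2 : x n = (1 + μ)⁻¹ • ((1 + μ) • x n) := by
        rw [smul_smul, inv_mul_cancel₀ hμ1.ne', one_smul]
      nth_rewrite 1 [h2]
      rw [← smul_sub, ← smul_add]
      congr 1
      module
    have h2 : ‖μ • x n‖ ≤ μ := by
      rw [norm_smul, Real.norm_of_nonneg hμ0.le]
      exact mul_le_of_le_one_right hμ0.le (hx1 n)
    rw [h1, norm_smul, norm_inv, Real.norm_of_nonneg hμ1.le, inv_mul_eq_div]
    gcongr
    exact (norm_add_le _ _).trans (add_le_add hn h2)

lemma AdmissibleRadius.one_add (hM : PropertyM X) {x : ℕ → X} (hx : WeakCauchy x)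
    (hx1 : ∀ n, ‖x n‖ ≤ 1) {g : X →L[ℝ] ℝ} {β : ℝ} (hβ : 0 < β)
    (hg : ∀ᶠ n in atTop, β ≤ g (x n)) {ε : ℝ} (hε : 0 < ε) :
    AdmissibleRadius x g β (1 + ε) := by
  obtain ⟨μ, hμ, hstep⟩ := AdmissibleRadius.average hM hx hx1 hβ hg
    (show 0 < ε / 4 by positivity)
  have hne : {R | AdmissibleRadius x g β R}.Nonempty := by
    obtain ⟨k, hk⟩ := hg.exists
    refine ⟨3, x k, x, hk, fun h l hl => hl, Eventually.of_forall fun m =>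
      Eventually.of_forall fun n => ?_⟩
    have h1 := norm_add_le (x k) (x n - x m)
    have h2 := norm_sub_le (x n) (x m)
    linarith [hx1 k, hx1 n, hx1 m]
  have hbdd : BddBelow {R | AdmissibleRadius x g β R} := ⟨0, fun R hR => hR.nonneg⟩
  set T := sInf {R | AdmissibleRadius x g β R} with hT
  have hTle : T * (1 + μ) - 2 * (ε / 4) * μ - μ ≤ T := by
    refine le_csInf hne fun R hR => ?_
    have h1 := csInf_le hbdd (hstep R hR)
    rw [← hT, le_div_iff₀ (by linarith)] at h1
    linarith
  have hT1 : T < 1 + ε := by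
    have h1 : μ * (T - (1 + ε / 2)) ≤ 0 := by linarith
    have h2 : T - (1 + ε / 2) ≤ 0 := nonpos_of_mul_nonpos_right h1 hμ
    linarith
  obtain ⟨R, ⟨c, e, h1, h2, h3⟩, hRε⟩ := exists_lt_of_csInf_lt hne hT1
  exact ⟨c, e, h1, h2, h3.mono fun m hm => hm.mono fun n hn => hn.trans hRε.le⟩

lemma PropertyM.exists_centre (hM : PropertyM X) {x : ℕ → X} (hx : WeakCauchy x)
    (hx1 : ∀ n, ‖x n‖ ≤ 1) (u : X →L[ℝ] ℝ) {b : ℝ}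
    (hb : Tendsto (fun n => u (x n)) atTop (𝓝 b)) {ε : ℝ} (hε : 0 < ε) :
    ∃ (c : X) (e : ℕ → X), b - ε ≤ ‖u‖ * ‖c‖ ∧ SameWeakLimits e x ∧
      ∀ᶠ m in atTop, ∀ᶠ n in atTop, ‖c + (x n - e m)‖ ≤ 1 + ε := by
  rcases lt_or_ge 0 b with hb0 | hb0
  · obtain ⟨c, e, hc, he, hce⟩ := AdmissibleRadius.one_add hM hx hx1
      (β := max (b - ε) (b / 2)) (lt_max_of_lt_right (by linarith))
      ((hb.eventually_const_lt (max_lt (by linarith) (by linarith))).mono fun n hn => hn.le) hε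
    exact ⟨c, e, ((le_max_left _ _).trans hc).trans ((le_abs_self _).trans (u.le_opNorm c)),
      he, hce⟩
  have hpos : ∀ c : X, b - ε ≤ ‖u‖ * ‖c‖ := fun c => by
    have : 0 ≤ ‖u‖ * ‖c‖ := by positivity
    linarith
  by_cases hnull : WeakNull x
  · refine ⟨0, fun _ => 0, hpos 0, fun h l hl => ?_, Eventually.of_forall fun m =>
      Eventually.of_forall fun n => ?_⟩
    · rw [tendsto_nhds_unique hl (hnull h)]
      simp
    · rw [zero_add, sub_zero]
      linarith [hx1 n]
  · obtain ⟨h, l, hl0, hl⟩ : ∃ (h : X →L[ℝ] ℝ) (l : ℝ), 0 < l ∧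
        Tendsto (fun n => h (x n)) atTop (𝓝 l) := by
      unfold WeakNull at hnull
      push Not at hnull
      obtain ⟨h, hh⟩ := hnull
      obtain ⟨l, hl⟩ := hx h
      rcases lt_trichotomy l 0 with h0 | h0 | h0
      · exact ⟨-h, -l, by linarith, by simpa using hl.neg⟩
      · exact absurd (h0 ▸ hl) hh
      · exact ⟨h, l, h0, hl⟩
    obtain ⟨c, e, -, he, hce⟩ := AdmissibleRadius.one_add hM hx hx1 (half_pos hl0)
      ((hl.eventually_const_lt (half_lt_self hl0)).mono fun n hn => hn.le) hε
    exact ⟨c, e, hpos c, he, hce⟩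

theorem PropertyM.propertyMStar (hM : PropertyM X)
    (hX : ¬ EmbedsIso (lp (fun _ : ℕ => ℝ) 1) X) : PropertyMStar X := by
  intro f hf u v huv
  obtain ⟨C, hC⟩ := hf.bounded
  refine limsup_norm_add_le hC fun R R' hRR' hR => ?_
  by_contra hcon
  have hfr : ∃ᶠ n in atTop, R' ≤ ‖f n + u‖ := by
    simpa only [Filter.not_eventually, not_lt] using hcon
  obtain ⟨φ, hφ, hφR⟩ := extraction_of_frequently_atTop hfr
  have hR0 : 0 ≤ R := by
    obtain ⟨n, hn⟩ := hR.exists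
    exact (norm_nonneg _).trans hn
  set ε := (R' - R) / (2 * (2 * R + 4)) with hε
  have hε0 : 0 < ε := div_pos (by linarith) (by linarith)
  have hεR : ε * (2 * R + 4) = (R' - R) / 2 := by rw [hε]; field_simp
  choose x hx1 hx using fun n => exists_norm_le_one_lt_apply
    (show R' - ε < ‖f (φ n) + u‖ by linarith [hφR n])
  obtain ⟨ψ, hψ, hconv⟩ := exists_weakCauchy_subseq hX hx1
  set y := fun n => x (ψ n) with hy
  have hyC : WeakCauchy y := hconv
  have hsub : Tendsto (fun n => φ (ψ n)) atTop atTop :=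
    hφ.tendsto_atTop.comp hψ.tendsto_atTop
  obtain ⟨b, hb⟩ := hyC u
  obtain ⟨a, ha⟩ := hyC v
  obtain ⟨c, e, hc, he, hce⟩ := hM.exists_centre hyC (fun n => hx1 _) u hb hε0
  obtain ⟨w, hwc, hvw⟩ := exists_norm_le_lt_apply v (norm_nonneg c) hε0
  have hiter := hM.eventually_eventually_le hyC he hwc
    (show 1 + ε < 1 + 2 * ε by linarith) hce
  obtain ⟨m, hm, hvm⟩ := (hiter.and ((he v a ha).eventually_lt_const
    (show a < a + ε by linarith))).exists
  have hF : WeakStarNull fun n => f (φ (ψ n)) := hf.comp hsub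
  have hlim : Tendsto (fun n => f (φ (ψ n)) w + (R' - ε - u (y n)) - f (φ (ψ n)) (e m)
      + v w + v (y n) - v (e m)) atTop (𝓝 (0 + (R' - ε - b) - 0 + v w + a - v (e m))) :=
    (((((hF w).add (tendsto_const_nhds.sub hb)).sub (hF (e m))).add tendsto_const_nhds).add
      ha).sub tendsto_const_nhds
  have hle : 0 + (R' - ε - b) - 0 + v w + a - v (e m) ≤ R * (1 + 2 * ε) := by
    refine le_of_tendsto hlim ?_
    filter_upwards [hm, hsub.eventually hR] with n hn hnR
    have h1 := (le_abs_self _).trans ((f (φ (ψ n)) + v).le_of_opNorm_le_of_le hnR hn)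
    have h2 := hx (ψ n)
    simp only [add_apply, map_add, map_sub] at h1 h2
    simp only [hy] at h1 ⊢
    linarith
  have h3 : ‖u‖ * ‖c‖ ≤ ‖v‖ * ‖c‖ := by gcongr
  linarith

end BlockCentres

theorem stmt13 (X : Type*) [NormedAddCommGroup X] [NormedSpace ℝ X] [CompleteSpace X]
    [TopologicalSpace.SeparableSpace X]
    :
    PropertyMStar X ↔ (PropertyM X ∧ ¬ EmbedsIso (lp (fun _ : ℕ => ℝ) 1) X) :=
  ⟨fun h => ⟨h.propertyM, h.not_embedsIso⟩, fun h => h.1.propertyMStar h.2⟩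
end

section
/- Let X be a separable real Banach space whose dual X* has Property(M*). If ℓ₁ does not embed isomorphically into X*, then X is reflexive. -/
open Filter Topology ZeroAtInfty

/-- A quantitative Helly lemma: an element of the bidual at distance at least `d` from `X` takes
values exceeding any `r < d` on unit functionals annihilating a given finite set. -/
theorem exists_annihilating_functional {X : Type*} [NormedAddCommGroup X] [NormedSpace ℝ X]
    (φ : StrongDual ℝ (StrongDual ℝ X)) {d r : ℝ}
    (hd : ∀ x, d ≤ ‖φ - NormedSpace.inclusionInDoubleDual ℝ X x‖) (hr : 0 ≤ r) (hrd : r < d)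
    (s : Finset X) :
    ∃ f : StrongDual ℝ X, ‖f‖ ≤ 1 ∧ (∀ x ∈ s, f x = 0) ∧ r < φ f := by
  by_contra! h
  set J := NormedSpace.inclusionInDoubleDual ℝ X
  let L : s → (StrongDual ℝ X →ₗ[ℝ] ℝ) := fun x => (J x : StrongDual ℝ X →ₗ[ℝ] ℝ)
  let F : Submodule ℝ (StrongDual ℝ X) := ⨅ i, (L i).ker
  have hF : ∀ f ∈ F, ∀ x ∈ s, f x = 0 := by
    intro f hf x hx
    have := (Submodule.mem_iInf _).1 hf ⟨x, hx⟩
    simpa [L, J] using this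
  obtain ⟨g, hg, hgn⟩ := exists_extension_norm_eq F (φ.comp F.subtypeL)
  have hgr : ‖g‖ ≤ r := by
    rw [hgn]
    refine ContinuousLinearMap.opNorm_le_of_unit_norm hr fun f hf => ?_
    have h1 := h f hf.le (hF f f.2)
    have h2 := h (-f : F) (by simpa using hf.le) (hF (-f : F) (-f : F).2)
    simp only [Submodule.coe_neg, map_neg] at h2
    simpa [Real.norm_eq_abs] using abs_le.2 ⟨by linarith, h1⟩
  have hmem : ((φ - g : StrongDual ℝ (StrongDual ℝ X)) : StrongDual ℝ X →ₗ[ℝ] ℝ) ∈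
      Submodule.span ℝ (Set.range L) := by
    refine mem_span_of_iInf_ker_le_ker fun f hf => ?_
    have := hg ⟨f, hf⟩
    simp at this
    simp [this]
  obtain ⟨c, hc⟩ := (Submodule.mem_span_range_iff_exists_fun ℝ).1 hmem
  have hy : φ - J (∑ i, c i • (i : X)) = g := by
    ext f
    have := LinearMap.congr_fun hc f
    simp [L, J] at this
    simp [J, this]
  have := hd (∑ i, c i • (i : X))
  rw [hy] at this
  linarith

/-- The dual of a separable nonreflexive Banach space contains a weak-star null sequence in its
unit ball that stays away from zero along an element of the bidual of norm at most one. -/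
theorem exists_weakStarNull_of_not_isReflexive {X : Type*} [NormedAddCommGroup X]
    [NormedSpace ℝ X] [CompleteSpace X] [TopologicalSpace.SeparableSpace X]
    (hX : ¬ IsReflexive X) :
    ∃ (φ : StrongDual ℝ (StrongDual ℝ X)) (δ : ℝ) (f : ℕ → StrongDual ℝ X),
      ‖φ‖ ≤ 1 ∧ 0 < δ ∧ (∀ n, ‖f n‖ ≤ 1) ∧ (∀ n, δ ≤ φ (f n)) ∧ WeakStarNull f := by
  classical
  set J := NormedSpace.inclusionInDoubleDual ℝ X
  obtain ⟨φ₀, hφ₀⟩ : ∃ φ₀, φ₀ ∉ Set.range J := by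
    simpa [IsReflexive, Function.Surjective] using hX
  have hφ₀0 : ‖φ₀‖ ≠ 0 := fun h => hφ₀ ⟨0, by
    rw [map_zero]; exact (φ₀.opNorm_zero_iff.1 h).symm⟩
  set φ := ‖φ₀‖⁻¹ • φ₀ with hφdef
  have hφn : ‖φ‖ ≤ 1 := by
    refine (ContinuousLinearMap.opNorm_smul_le _ φ₀).trans_eq ?_
    rw [Real.norm_of_nonneg (inv_nonneg.2 φ₀.opNorm_nonneg), inv_mul_cancel₀ hφ₀0]
  have hφ : φ ∉ Set.range J := by
    rintro ⟨x, hx⟩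
    exact hφ₀ ⟨‖φ₀‖ • x, by rw [map_smul, hx, hφdef, smul_inv_smul₀ hφ₀0]⟩
  have hclosed : IsClosed (Set.range J) :=
    (NormedSpace.inclusionInDoubleDualLi ℝ (E := X)).isometry.isUniformInducing.isComplete_range.isClosed
  have hpos : 0 < Metric.infDist φ (Set.range J) :=
    (hclosed.notMem_iff_infDist_pos (Set.range_nonempty _)).1 hφ
  set d := Metric.infDist φ (Set.range J)
  have hd : ∀ x, d ≤ ‖φ - J x‖ := fun x =>
    (Metric.infDist_le_dist_of_mem (Set.mem_range_self x)).trans_eq (dist_eq_norm φ (J x))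
  choose f hf1 hf0 hfd using fun n : ℕ => exists_annihilating_functional φ hd
    (half_pos hpos).le (half_lt_self hpos)
    ((Finset.range n).image (TopologicalSpace.denseSeq X))
  refine ⟨φ, d / 2, f, hφn, half_pos hpos, hf1, fun n => (hfd n).le, fun x => ?_⟩
  rw [Metric.tendsto_atTop]
  intro ε hε
  obtain ⟨k, hk⟩ := (TopologicalSpace.denseRange_denseSeq X).exists_dist_lt x hε
  refine ⟨k + 1, fun n hn => ?_⟩
  have hz : f n (TopologicalSpace.denseSeq X k) = 0 :=
    hf0 n _ (Finset.mem_image_of_mem _ (Finset.mem_range.2 hn))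
  calc dist (f n x) 0 = ‖f n (x - TopologicalSpace.denseSeq X k)‖ := by
        rw [map_sub, hz, dist_zero_right, sub_zero]
    _ ≤ 1 * ‖x - TopologicalSpace.denseSeq X k‖ := (f n).le_of_opNorm_le (hf1 n) _
    _ < ε := by rwa [one_mul, ← dist_eq_norm]

theorem PropertyMStar.eventually_norm_add_le {X : Type*} [NormedAddCommGroup X] [NormedSpace ℝ X]
    (hM : PropertyMStar X) {f : ℕ → StrongDual ℝ X} (hf : WeakStarNull f) {C : ℝ}
    (hC : ∀ n, ‖f n‖ ≤ C) {u v : StrongDual ℝ X} (huv : ‖v‖ ≤ ‖u‖) {ε : ℝ} (hε : 0 < ε) :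
    ∀ᶠ n in atTop, ‖f n + v‖ ≤ ‖f n + u‖ + ε := by
  by_contra h
  obtain ⟨ψ, hψ, hlt⟩ := extraction_of_frequently_atTop (not_eventually.1 h)
  have hbdd : ∀ w : StrongDual ℝ X,
      IsBoundedUnder (· ≤ ·) atTop fun n => ‖f (ψ n) + w‖ := fun w =>
    isBoundedUnder_of ⟨C + ‖w‖, fun n =>
      (norm_add_le _ _).trans (add_le_add_left (hC _) _)⟩
  have hcobdd : ∀ w : StrongDual ℝ X,
      IsCoboundedUnder (· ≤ ·) atTop fun n => ‖f (ψ n) + w‖ := fun w =>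
    (isBoundedUnder_of ⟨0, fun n => norm_nonneg _⟩ :
      IsBoundedUnder (· ≥ ·) atTop fun n => ‖f (ψ n) + w‖).isCoboundedUnder_le
  have h1 := hM (fun n => f (ψ n)) (fun x => (hf x).comp hψ.tendsto_atTop) v u huv
  have h2 := limsup_add_const atTop (fun n => ‖f (ψ n) + u‖) ε (hbdd u) (hcobdd u)
  have h3 : limsup (fun n => ‖f (ψ n) + u‖ + ε) atTop ≤ limsup (fun n => ‖f (ψ n) + v‖) atTop :=
    limsup_le_limsup (Eventually.of_forall fun n => (not_le.1 (hlt n)).le)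
      (by
        refine IsBoundedUnder.isCoboundedUnder_le (isBoundedUnder_of ⟨0, fun n => ?_⟩)
        change 0 ≤ ‖f (ψ n) + u‖ + ε
        positivity) (hbdd v)
  linarith

/-- Property (M*) holds uniformly on compact sets of functionals. -/
theorem PropertyMStar.eventually_forall_norm_smul_add_le {X : Type*} [NormedAddCommGroup X]
    [NormedSpace ℝ X] (hM : PropertyMStar X) {f : ℕ → StrongDual ℝ X} (hf : WeakStarNull f)
    (hf1 : ∀ n, ‖f n‖ ≤ 1) {K : Set (StrongDual ℝ X)} (hK : IsCompact K) {ε : ℝ} (hε : 0 < ε) :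
    ∀ᶠ n in atTop, ∀ u ∈ K, ∀ v ∈ K, ‖v‖ ≤ ‖u‖ → ∀ b ∈ Set.Icc (0 : ℝ) 1,
      ‖b • f n + v‖ ≤ ‖b • f n + u‖ + ε := by
  let S : Set (StrongDual ℝ X × StrongDual ℝ X × ℝ) :=
    (K ×ˢ K ×ˢ Set.Icc 0 1) ∩ {p | ‖p.2.1‖ ≤ ‖p.1‖}
  have hS : IsCompact S := (hK.prod (hK.prod isCompact_Icc)).inter_right
    (isClosed_le (by fun_prop) (by fun_prop))
  suffices h : ∀ᶠ n in atTop, ∀ p ∈ S,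
      ‖p.2.2 • f n + p.2.1‖ ≤ ‖p.2.2 • f n + p.1‖ + ε by
    filter_upwards [h] with n hn u hu v hv huv b hb
    exact hn (u, v, b) ⟨⟨hu, hv, hb⟩, huv⟩
  refine hS.induction_on (p := fun T => ∀ᶠ n in atTop, ∀ p ∈ T,
      ‖p.2.2 • f n + p.2.1‖ ≤ ‖p.2.2 • f n + p.1‖ + ε) (by simp)
    (fun s t hst ht => ht.mono fun n hn p hp => hn p (hst hp))
    (fun s t hs ht => (hs.and ht).mono fun n hn p hp => hp.elim (hn.1 p) (hn.2 p)) ?_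
  rintro ⟨u, v, b⟩ ⟨⟨-, -, hb⟩, huv⟩
  have hε8 : 0 < ε / 8 := by positivity
  refine ⟨Metric.ball (u, v, b) (ε / 8),
    mem_nhdsWithin_of_mem_nhds (Metric.ball_mem_nhds _ hε8), ?_⟩
  have hbf : ∀ n, ‖b • f n‖ ≤ 1 := fun n => by
    rw [norm_smul, Real.norm_of_nonneg hb.1]
    exact mul_le_one₀ hb.2 (norm_nonneg _) (hf1 n)
  have hnull : WeakStarNull fun n => b • f n := fun x => by
    simpa using (hf x).const_mul b
  filter_upwards [hM.eventually_norm_add_le hnull hbf huv (half_pos hε)] with n hn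
  rintro ⟨u', v', b'⟩ hp
  rw [Metric.mem_ball, Prod.dist_eq, Prod.dist_eq, max_lt_iff, max_lt_iff, dist_eq_norm,
    dist_eq_norm, dist_eq_norm] at hp
  obtain ⟨hu, hv, hb'⟩ := hp
  have hbb : ‖(b' - b) • f n‖ ≤ ε / 8 := by
    rw [norm_smul]
    nlinarith [hf1 n, norm_nonneg (f n), norm_nonneg (b' - b)]
  have h1 : ‖b' • f n + v'‖ ≤ ‖b • f n + v‖ + ‖(b' - b) • f n‖ + ‖v' - v‖ :=
    calc ‖b' • f n + v'‖ = ‖(b • f n + v) + (b' - b) • f n + (v' - v)‖ := by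
          congr 1; module
      _ ≤ _ := norm_add₃_le
  have h2 : ‖b • f n + u‖ ≤ ‖b' • f n + u'‖ + ‖(b' - b) • f n‖ + ‖u' - u‖ :=
    calc ‖b • f n + u‖ = ‖(b' • f n + u') - (b' - b) • f n - (u' - u)‖ := by
          congr 1; module
      _ ≤ _ := (norm_sub_le _ _).trans (by gcongr; exact norm_sub_le _ _)
  change ‖b' • f n + v'‖ ≤ ‖b' • f n + u'‖ + ε
  linarith

theorem isCompact_span_inter_closedBall {E : Type*} [NormedAddCommGroup E] [NormedSpace ℝ E]
    {s : Set E} (hs : s.Finite) (r : ℝ) :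
    IsCompact ((Submodule.span ℝ s : Set E) ∩ Metric.closedBall 0 r) := by
  have := FiniteDimensional.span_of_finite ℝ hs
  have h := (isCompact_closedBall (0 : Submodule.span ℝ s) r).image continuous_subtype_val
  convert h using 1
  ext x
  simp only [Set.mem_inter_iff, SetLike.mem_coe, mem_closedBall_zero_iff, Set.mem_image,
    Subtype.exists, exists_and_right, exists_eq_right, Submodule.coe_norm, exists_prop]

/-- Under Property (M*), a weak-star null sequence in the unit ball has a subsequence that is
unconditional up to an arbitrarily small additive error. -/
theorem PropertyMStar.exists_almost_unconditional {X : Type*} [NormedAddCommGroup X]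
    [NormedSpace ℝ X] (hM : PropertyMStar X) {f : ℕ → StrongDual ℝ X} (hf : WeakStarNull f)
    (hf1 : ∀ n, ‖f n‖ ≤ 1) {ε : ℝ} (hε : 0 < ε) :
    ∃ ψ : ℕ → ℕ, ∀ (a : ℕ → ℝ) (m : ℕ), ∑ i ∈ Finset.range m, |a i| ≤ 1 →
      ‖∑ i ∈ Finset.range m, |a i| • f (ψ i)‖ ≤ ‖∑ i ∈ Finset.range m, a i • f (ψ i)‖ + ε := by
  let K : ℕ → Set (StrongDual ℝ X) := fun N =>
    (Submodule.span ℝ (f '' Set.Iio N) : Set (StrongDual ℝ X)) ∩ Metric.closedBall 0 1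
  let η : ℕ → ℝ := fun n => ε / 2 / 2 ^ n
  have hη : ∀ n, 0 < η n := fun n => by positivity
  have hex : ∀ N, ∃ n, N ≤ n ∧ ∀ u ∈ K N, ∀ v ∈ K N, ‖v‖ ≤ ‖u‖ → ∀ b ∈ Set.Icc (0 : ℝ) 1,
      ‖b • f n + v‖ ≤ ‖b • f n + u‖ + η N := fun N =>
    ((eventually_ge_atTop N).and (hM.eventually_forall_norm_smul_add_le hf hf1
      (isCompact_span_inter_closedBall ((Set.finite_Iio N).image f) 1) (hη N))).exists
  choose g hgN hg using hex
  let M : ℕ → ℕ := fun k => Nat.rec 0 (fun _ N => g N + 1) k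
  have hMs : ∀ k, M (k + 1) = g (M k) + 1 := fun _ => rfl
  have hMmono : StrictMono M := strictMono_nat_of_lt_succ fun k => by
    rw [hMs]; exact Nat.lt_succ_of_le (hgN _)
  have hmem : ∀ (c : ℕ → ℝ) m, ∑ i ∈ Finset.range m, |c i| ≤ 1 →
      ∑ i ∈ Finset.range m, c i • f (g (M i)) ∈ K (M m) := fun c m hc => by
    refine ⟨Submodule.sum_mem _ fun i hi => Submodule.smul_mem _ _ (Submodule.subset_span
      ⟨_, ?_, rfl⟩), ?_⟩
    · have : M (i + 1) ≤ M m := hMmono.monotone (Finset.mem_range.1 hi)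
      rw [hMs] at this
      exact this
    · rw [mem_closedBall_zero_iff]
      refine (norm_sum_le _ _).trans (le_trans (Finset.sum_le_sum fun i _ => ?_) hc)
      rw [norm_smul, Real.norm_eq_abs]
      exact mul_le_of_le_one_right (abs_nonneg _) (hf1 _)
  refine ⟨fun k => g (M k), fun a m hm => ?_⟩
  have key : ‖∑ i ∈ Finset.range m, |a i| • f (g (M i))‖ ≤
      ‖∑ i ∈ Finset.range m, a i • f (g (M i))‖ + ∑ i ∈ Finset.range m, η i := by
    induction m with
    | zero => simp
    | succ m ih =>
      rw [Finset.sum_range_succ] at hm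
      have hm' : ∑ i ∈ Finset.range m, |a i| ≤ 1 := by linarith [abs_nonneg (a m)]
      have hb : |a m| ∈ Set.Icc (0 : ℝ) 1 := ⟨abs_nonneg _, by
        linarith [Finset.sum_nonneg fun i (_ : i ∈ Finset.range m) => abs_nonneg (a i)]⟩
      have ih := ih hm'
      simp only [Finset.sum_range_succ]
      set u := ∑ i ∈ Finset.range m, a i • f (g (M i))
      set v := ∑ i ∈ Finset.range m, |a i| • f (g (M i))
      have huK : u ∈ K (M m) := hmem a m hm'
      have hvK : v ∈ K (M m) := hmem (fun i => |a i|) m (by simpa using hm')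
      set F := f (g (M m))
      have hηm : η (M m) ≤ η m := by
        simp only [η]
        gcongr
        · norm_num
        · exact hMmono.id_le m
      obtain ⟨w, hwK, hwu, hwa⟩ : ∃ w ∈ K (M m), ‖w‖ = ‖u‖ ∧
          ‖|a m| • F + w‖ = ‖u + a m • F‖ := by
        rcases le_total 0 (a m) with h | h
        · exact ⟨u, huK, rfl, by rw [abs_of_nonneg h, add_comm]⟩
        · refine ⟨-u, ⟨neg_mem huK.1, by simpa using huK.2⟩, norm_neg u, ?_⟩
          rw [abs_of_nonpos h, ← norm_neg]
          congr 1; module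
      obtain ⟨v', hv'K, hv'u, hv'⟩ : ∃ v' ∈ K (M m), ‖v'‖ ≤ ‖u‖ ∧
          ‖v - v'‖ ≤ ∑ i ∈ Finset.range m, η i := by
        rcases le_or_gt ‖v‖ ‖u‖ with h | h
        · exact ⟨v, hvK, h, by simpa using Finset.sum_nonneg fun i _ => (hη i).le⟩
        · have hv0 : 0 < ‖v‖ := (norm_nonneg u).trans_lt h
          have hn : ‖(‖u‖ / ‖v‖) • v‖ = ‖u‖ := by
            rw [norm_smul, norm_div, norm_norm, norm_norm, div_mul_cancel₀ _ hv0.ne']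
          refine ⟨(‖u‖ / ‖v‖) • v, ⟨Submodule.smul_mem _ _ hvK.1, ?_⟩, hn.le, ?_⟩
          · rw [mem_closedBall_zero_iff, hn]
            simpa using huK.2
          · have : v - (‖u‖ / ‖v‖) • v = (1 - ‖u‖ / ‖v‖) • v := by module
            rw [this, norm_smul, Real.norm_of_nonneg (sub_nonneg.2 ((div_le_one hv0).2 h.le)),
              sub_mul, div_mul_cancel₀ _ hv0.ne']
            linarith
      have h1 := hg (M m) w hwK v' hv'K (by rw [hwu]; exact hv'u) |a m| hb
      have h2 : ‖v + |a m| • F‖ ≤ ‖|a m| • F + v'‖ + ‖v - v'‖ :=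
        calc ‖v + |a m| • F‖ = ‖(|a m| • F + v') + (v - v')‖ := by congr 1; module
          _ ≤ _ := norm_add_le _ _
      linarith
  refine key.trans (add_le_add_right ?_ _)
  calc ∑ i ∈ Finset.range m, η i ≤ ∑' i, η i :=
        (summable_geometric_two' ε).sum_le_tsum _ fun i _ => (hη i).le
    _ = ε := tsum_geometric_two' ε

/-- A bounded sequence that is bounded below by the `ℓ¹` norm up to an additive error
spans a copy of `ℓ¹`. -/
theorem embedsIso_lp_one_of_le_norm_sum {E : Type*} [NormedAddCommGroup E] [NormedSpace ℝ E]
    [CompleteSpace E] {x : ℕ → E} (hx : ∀ n, ‖x n‖ ≤ 1) {δ ε : ℝ} (hεδ : ε < δ)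
    (h : ∀ (a : ℕ → ℝ) (m : ℕ), ∑ i ∈ Finset.range m, |a i| ≤ 1 →
      δ * ∑ i ∈ Finset.range m, |a i| ≤ ‖∑ i ∈ Finset.range m, a i • x i‖ + ε) :
    EmbedsIso (lp (fun _ : ℕ => ℝ) 1) E := by
  have hsum : ∀ y : lp (fun _ : ℕ => ℝ) 1, Summable fun n => |y n| := fun y => by
    simpa using (memℓp_gen_iff (by simp)).1 (lp.memℓp y)
  have hnorm : ∀ y : lp (fun _ : ℕ => ℝ) 1, ‖y‖ = ∑' n, |y n| := fun y => by
    simpa using lp.norm_eq_tsum_rpow (by simp) y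
  have hle : ∀ (y : lp (fun _ : ℕ => ℝ) 1) n, ‖y n • x n‖ ≤ |y n| := fun y n => by
    rw [norm_smul, Real.norm_eq_abs]
    exact mul_le_of_le_one_right (abs_nonneg _) (hx n)
  have hs : ∀ y : lp (fun _ : ℕ => ℝ) 1, Summable fun n => y n • x n := fun y =>
    (hsum y).of_norm_bounded (hle y)
  let T₀ : lp (fun _ : ℕ => ℝ) 1 →ₗ[ℝ] E :=
    { toFun := fun y => ∑' n, y n • x n
      map_add' := fun y z => by
        rw [← (hs y).tsum_add (hs z)]
        simp [add_smul]
      map_smul' := fun c y => by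
        rw [RingHom.id_apply, ← (hs y).tsum_const_smul c]
        simp [mul_smul] }
  let T : lp (fun _ : ℕ => ℝ) 1 →L[ℝ] E := T₀.mkContinuous 1 fun y => by
    rw [one_mul, hnorm]
    exact tsum_of_norm_bounded (hsum y).hasSum (hle y)
  have hT : ∀ y, T y = ∑' n, y n • x n := fun _ => rfl
  have hunit : ∀ y, ‖y‖ = 1 → δ - ε ≤ ‖T y‖ := fun y hy => by
    have h1 : Tendsto (fun m => ∑ i ∈ Finset.range m, |y i|) atTop (𝓝 1) := by
      rw [← hy, hnorm]
      exact (hsum y).hasSum.tendsto_sum_nat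
    have h2 : Tendsto (fun m => ∑ i ∈ Finset.range m, y i • x i) atTop (𝓝 (T y)) :=
      (hs y).hasSum.tendsto_sum_nat
    have h3 := le_of_tendsto_of_tendsto' (h1.const_mul δ) (h2.norm.add_const ε) fun m =>
      h y m (by
        rw [← hy, hnorm]
        exact (hsum y).sum_le_tsum _ fun i _ => abs_nonneg _)
    linarith
  have hbelow : ∀ y, (δ - ε) * ‖y‖ ≤ ‖T y‖ := fun y => by
    rcases eq_or_ne y 0 with rfl | hy
    · simp
    · have hy' : 0 < ‖y‖ := norm_pos_iff.2 hy
      have := hunit (‖y‖⁻¹ • y) (by rw [norm_smul, norm_inv, norm_norm, inv_mul_cancel₀ hy'.ne'])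
      rwa [map_smul, norm_smul, norm_inv, norm_norm, ← div_eq_inv_mul, le_div_iff₀ hy'] at this
  have hc : 0 < δ - ε := sub_pos.2 hεδ
  refine ⟨T, (injective_iff_map_eq_zero T).2 fun y hy => ?_, δ - ε, hc, hbelow⟩
  have := hbelow y
  rw [hy, norm_zero] at this
  exact norm_le_zero_iff.1 (nonpos_of_mul_nonpos_right this hc)

theorem stmt14 (X : Type*) [NormedAddCommGroup X] [NormedSpace ℝ X] [CompleteSpace X]
    [TopologicalSpace.SeparableSpace X]
    (hM : PropertyMStar X) (hl : ¬ EmbedsIso (lp (fun _ : ℕ => ℝ) 1) (X →L[ℝ] ℝ)) :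
    IsReflexive X := by
  by_contra hX
  obtain ⟨φ, δ, f, hφ, hδ, hf1, hfδ, hf⟩ := exists_weakStarNull_of_not_isReflexive hX
  obtain ⟨ψ, hψ⟩ := hM.exists_almost_unconditional hf hf1 (half_pos hδ)
  refine hl (embedsIso_lp_one_of_le_norm_sum (fun n => hf1 (ψ n)) (half_lt_self hδ)
    fun a m ham => le_trans ?_ (hψ a m ham))
  calc δ * ∑ i ∈ Finset.range m, |a i|
      ≤ φ (∑ i ∈ Finset.range m, |a i| • f (ψ i)) := by
        rw [map_sum, Finset.mul_sum]
        refine Finset.sum_le_sum fun i _ => ?_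
        rw [map_smul, smul_eq_mul, mul_comm]
        exact mul_le_mul_of_nonneg_left (hfδ _) (abs_nonneg _)
    _ ≤ ‖φ (∑ i ∈ Finset.range m, |a i| • f (ψ i))‖ := Real.le_norm_self _
    _ ≤ 1 * ‖∑ i ∈ Finset.range m, |a i| • f (ψ i)‖ := φ.le_of_opNorm_le hφ _
    _ = ‖∑ i ∈ Finset.range m, |a i| • f (ψ i)‖ := one_mul _
end

section
/- Let X be a separable real Banach space whose dual X* has Property(M*). If c₀ does not embed isomorphically into X, then X is reflexive. -/
open Filter Topology ZeroAtInfty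

section Duality

variable {E : Type*} [NormedAddCommGroup E] [NormedSpace ℝ E]

theorem exists_norm_le_one_lt_apply_s15 (φ : E →L[ℝ] ℝ) {ε : ℝ} (hε : 0 < ε) :
    ∃ x : E, ‖x‖ ≤ 1 ∧ ‖φ‖ - ε < φ x := by
  obtain ⟨x, hx, h⟩ := φ.exists_lt_apply_of_lt_opNorm (sub_lt_self ‖φ‖ hε)
  rcases le_total 0 (φ x) with h0 | h0
  · exact ⟨x, hx.le, by rwa [Real.norm_of_nonneg h0] at h⟩
  · exact ⟨-x, by simpa using hx.le, by rwa [Real.norm_of_nonpos h0, ← map_neg] at h⟩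

theorem sum_norm_le_of_forall_sum_apply_le {ι : Type*} [Fintype ι] (φ : ι → E →L[ℝ] ℝ) {C : ℝ}
    (h : ∀ w : ι → E, (∀ i, ‖w i‖ ≤ 1) → ∑ i, φ i (w i) ≤ C) : ∑ i, ‖φ i‖ ≤ C := by
  refine le_of_forall_pos_le_add fun ε hε => ?_
  have hc : (0 : ℝ) < Fintype.card ι + 1 := by positivity
  choose w hw1 hw2 using fun i => exists_norm_le_one_lt_apply_s15 (φ i) (div_pos hε hc)
  have h1 : ∑ i, (‖φ i‖ - ε / (Fintype.card ι + 1)) ≤ ∑ i, φ i (w i) :=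
    Finset.sum_le_sum fun i _ => (hw2 i).le
  have h2 : (Fintype.card ι : ℝ) * (ε / (Fintype.card ι + 1)) ≤ ε := by
    rw [← mul_div_assoc, div_le_iff₀ hc]
    nlinarith
  simp only [Finset.sum_sub_distrib, Finset.sum_const, Finset.card_univ, nsmul_eq_mul] at h1
  linarith [h w hw1]

/-- A finite family can be translated by a common vector of `Y` into a ball of radius slightly
larger than `r` as soon as no functional obstructs it. -/
theorem exists_forall_norm_sub_lt_of_dual {ι : Type*} [Fintype ι] (Y : Submodule ℝ E) (a : ι → E)
    {r ε : ℝ} (hr : 0 ≤ r) (hε : 0 < ε)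
    (h : ∀ φ : ι → E →L[ℝ] ℝ, (∀ y ∈ Y, ∑ i, φ i y = 0) → ∑ i, φ i (a i) ≤ r * ∑ i, ‖φ i‖) :
    ∃ y ∈ Y, ∀ i, ‖a i - y‖ < r + ε := by
  classical
  by_contra! hcon
  have hR : 0 < r + ε := by positivity
  let A : Set (ι → E) := (fun y i => a i - y) '' (Y : Set E)
  have hA : Convex ℝ A := by
    rintro _ ⟨y, hy, rfl⟩ _ ⟨z, hz, rfl⟩ s t hs ht hst
    refine ⟨s • y + t • z, Y.add_mem (Y.smul_mem _ hy) (Y.smul_mem _ hz), funext fun i => ?_⟩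
    simp only [Pi.add_apply, Pi.smul_apply, smul_sub]
    nth_rewrite 1 [← one_smul ℝ (a i), ← hst, add_smul]
    abel
  have hdisj : Disjoint (Metric.ball (0 : ι → E) (r + ε)) A := by
    rw [Set.disjoint_left]
    rintro _ hw ⟨y, hy, rfl⟩
    rw [mem_ball_zero_iff, pi_norm_lt_iff hR] at hw
    obtain ⟨i, hi⟩ := hcon y hy
    exact absurd (hw i) (not_lt.2 hi)
  obtain ⟨Φ, u, hu1, hu2⟩ :=
    geometric_hahn_banach_open (convex_ball _ _) Metric.isOpen_ball hA hdisj
  let φ : ι → E →L[ℝ] ℝ := fun i => Φ.comp (ContinuousLinearMap.single ℝ (fun _ : ι => E) i)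
  have hφ : ∀ w : ι → E, Φ w = ∑ i, φ i (w i) := by
    intro w
    nth_rewrite 1 [← Finset.univ_sum_single w]
    simp [φ]
  have hu0 : 0 < u := by simpa using hu1 0 (by simpa using hR)
  have hY : ∀ y ∈ Y, ∑ i, φ i y = 0 := by
    intro y hy
    by_contra hne
    have key : ∀ t : ℝ, u ≤ (∑ i, φ i (a i)) - t * ∑ i, φ i y := by
      intro t
      have := hu2 _ ⟨t • y, Y.smul_mem t hy, rfl⟩
      rw [hφ] at this
      simpa [Finset.sum_sub_distrib, Finset.mul_sum] using this
    have := key ((∑ i, φ i (a i)) / ∑ i, φ i y)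
    rw [div_mul_cancel₀ _ hne] at this
    linarith
  have h1 := h φ hY
  have h2 : u ≤ ∑ i, φ i (a i) := by
    have := hu2 _ ⟨0, Y.zero_mem, rfl⟩
    rw [hφ] at this
    simpa using this
  have hρ : 0 < r + ε / 2 := by positivity
  have h3 : ∑ i, ‖φ i‖ ≤ u / (r + ε / 2) := by
    refine sum_norm_le_of_forall_sum_apply_le φ fun w hw => ?_
    have := hu1 ((r + ε / 2) • w) (by
      rw [mem_ball_zero_iff, norm_smul, Real.norm_of_nonneg hρ.le]
      have : ‖w‖ ≤ 1 := (pi_norm_le_iff_of_nonneg zero_le_one).2 hw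
      nlinarith)
    rw [map_smul, hφ, smul_eq_mul] at this
    rw [le_div_iff₀ hρ]
    linarith
  rw [le_div_iff₀ hρ] at h3
  have h4 : 0 ≤ ∑ i, ‖φ i‖ := Finset.sum_nonneg fun i _ => norm_nonneg _
  rcases h4.eq_or_lt with h5 | h5
  · rw [← h5] at h1
    linarith
  · nlinarith

/-- **Goldstine's theorem**: a functional on the dual is approximated on finitely many points by
evaluations at vectors of almost the same norm. -/
theorem exists_norm_le_forall_abs_sub_lt {ι : Type*} [Fintype ι] (w : ι → E →L[ℝ] ℝ)
    (Ψ : (E →L[ℝ] ℝ) →L[ℝ] ℝ) {ε : ℝ} (hε : 0 < ε) :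
    ∃ g : E, ‖g‖ ≤ ‖Ψ‖ ∧ ∀ i, |w i g - Ψ (w i)| < ε := by
  classical
  let T : E →L[ℝ] (ι → ℝ) := ContinuousLinearMap.pi w
  have hmem : (fun i => Ψ (w i)) ∈ closure (T '' Metric.closedBall 0 ‖Ψ‖) := by
    by_contra hx
    obtain ⟨f, u, hf1, hf2⟩ := geometric_hahn_banach_closed_point
      ((convex_closedBall (0 : E) ‖Ψ‖).linear_image T.toLinearMap).closure isClosed_closure hx
    let c : ι → ℝ := fun i => f (Pi.single i 1)
    have hfc : ∀ v : ι → ℝ, f v = ∑ i, v i * c i := by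
      intro v
      nth_rewrite 1 [pi_eq_sum_univ' v]
      simp [c, Pi.single]
    let W : E →L[ℝ] ℝ := f.comp T
    have hW : W = ∑ i, c i • w i := by
      ext g
      simp [W, hfc, T, mul_comm]
    have h1 : Ψ W = f (fun i => Ψ (w i)) := by
      simp [hW, hfc, mul_comm]
    have h2 : ‖Ψ‖ * ‖W‖ ≤ u := by
      refine le_of_forall_pos_le_add fun δ hδ => ?_
      obtain ⟨g, hg, hgW⟩ := exists_norm_le_one_lt_apply_s15 W
        (show 0 < δ / (‖Ψ‖ + 1) by positivity)
      have := hf1 (T (‖Ψ‖ • g)) (subset_closure ⟨_, by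
        rw [mem_closedBall_zero_iff, norm_smul, Real.norm_of_nonneg (norm_nonneg Ψ)]
        exact mul_le_of_le_one_right (norm_nonneg _) hg, rfl⟩)
      have h3 : ‖Ψ‖ * W g < u := by
        rw [map_smul, map_smul] at this
        exact this
      have h4 : ‖Ψ‖ * (δ / (‖Ψ‖ + 1)) ≤ δ := by
        rw [← mul_div_assoc, div_le_iff₀ (by positivity)]
        nlinarith
      nlinarith [mul_le_mul_of_nonneg_left hgW.le (norm_nonneg Ψ)]
    have h5 := (le_abs_self _).trans (Ψ.le_opNorm W)
    linarith
  obtain ⟨_, ⟨g, hg, rfl⟩, hdist⟩ := Metric.mem_closure_iff.1 hmem ε hε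
  refine ⟨g, by simpa using hg, fun i => ?_⟩
  have := (dist_pi_lt_iff hε).1 hdist i
  rwa [Real.dist_eq, abs_sub_comm] at this

end Duality

section MStar

set_option maxSynthPendingDepth 3

variable {X : Type*} [NormedAddCommGroup X] [NormedSpace ℝ X]

/-- A norm-bounded sequence of functionals tending to zero on a dense sequence is weak* null. -/
theorem weakStarNull_of_tendsto_of_dense {f : ℕ → X →L[ℝ] ℝ} {R : ℝ} (hR : ∀ n, ‖f n‖ ≤ R)
    {D : Set X} (hD : Dense D) (h : ∀ x ∈ D, Tendsto (fun n => f n x) atTop (nhds 0)) :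
    WeakStarNull f := by
  intro x
  have hR0 : 0 ≤ R := (norm_nonneg _).trans (hR 0)
  rw [Metric.tendsto_atTop]
  intro ε hε
  obtain ⟨y, hy, hxy⟩ := Metric.mem_closure_iff.1 (hD x) (ε / (2 * (R + 1))) (by positivity)
  obtain ⟨N, hN⟩ := Metric.tendsto_atTop.1 (h y hy) (ε / 2) (by positivity)
  refine ⟨N, fun n hn => ?_⟩
  have h1 := hN n hn
  rw [dist_zero_right] at h1 ⊢
  rw [dist_eq_norm, lt_div_iff₀ (by positivity)] at hxy
  have h2 : ‖f n (x - y)‖ ≤ R * ‖x - y‖ := (f n).le_of_opNorm_le (hR n) _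
  have h3 : f n x = f n (x - y) + f n y := by simp
  rw [h3]
  have h4 := norm_add_le (f n (x - y)) (f n y)
  nlinarith [norm_nonneg (x - y)]

/-- Property (M*) holds up to `ε` on some basic weak* neighbourhood of zero in a ball. -/
theorem PropertyMStar.exists_finite_norm_add_le [TopologicalSpace.SeparableSpace X]
    (hM : PropertyMStar X) {u v : X →L[ℝ] ℝ} (huv : ‖u‖ ≤ ‖v‖) (R : ℝ) {ε : ℝ} (hε : 0 < ε) :
    ∃ n : ℕ, ∀ f : X →L[ℝ] ℝ, ‖f‖ ≤ R →
      (∀ k ≤ n, |f (TopologicalSpace.denseSeq X k)| ≤ 1 / (n + 1 : ℝ)) →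
      ‖f + u‖ ≤ ‖f + v‖ + ε := by
  by_contra! hcon
  choose f hfR hfd hf using hcon
  have hnull : WeakStarNull f := by
    refine weakStarNull_of_tendsto_of_dense hfR (TopologicalSpace.denseRange_denseSeq X) ?_
    rintro _ ⟨k, rfl⟩
    refine squeeze_zero_norm' ?_ tendsto_one_div_add_atTop_nhds_zero_nat
    filter_upwards [eventually_ge_atTop k] with n hn
    exact hfd n k hn
  have hb : ∀ w : X →L[ℝ] ℝ, ∀ n, ‖f n + w‖ ∈ Set.Icc 0 (R + ‖w‖) := fun w n =>
    ⟨norm_nonneg _, (norm_add_le _ _).trans (by linarith [hfR n])⟩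
  obtain ⟨L, -, s, hs, hL⟩ := tendsto_subseq_of_bounded (Metric.isBounded_Icc _ _) (hb v)
  have h1 := hM (fun n => f (s n)) (fun x => (hnull x).comp hs.tendsto_atTop) u v huv
  have h2 : limsup (fun n => ‖f (s n) + v‖) atTop = L := hL.limsup_eq
  have h3 : Tendsto (fun n => ‖f (s n) + v‖ + ε) atTop (nhds (L + ε)) := hL.add_const ε
  have h4 : L + ε ≤ limsup (fun n => ‖f (s n) + u‖) atTop := by
    rw [← h3.limsup_eq]
    refine limsup_le_limsup (Eventually.of_forall fun n => (hf (s n)).le) ?_ ?_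
    · exact h3.isCoboundedUnder_le
    · exact isBoundedUnder_of ⟨R + ‖u‖, fun n => (hb u (s n)).2⟩
  linarith

open NormedSpace in
/-- Under (M*), the norm of `φ + u`, for `φ` annihilating `X` and `u` a functional on `X`, is
monotone in `‖u‖`. -/
theorem PropertyMStar.norm_add_inclusion_mono [TopologicalSpace.SeparableSpace X]
    (hM : PropertyMStar X) {u v : X →L[ℝ] ℝ} (huv : ‖u‖ ≤ ‖v‖)
    (φ : ((X →L[ℝ] ℝ) →L[ℝ] ℝ) →L[ℝ] ℝ) (hφ : ∀ x, φ (inclusionInDoubleDual ℝ X x) = 0) :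
    ‖φ + inclusionInDoubleDual ℝ (X →L[ℝ] ℝ) u‖ ≤
      ‖φ + inclusionInDoubleDual ℝ (X →L[ℝ] ℝ) v‖ := by
  set J := inclusionInDoubleDual ℝ (X →L[ℝ] ℝ)
  refine le_of_forall_pos_le_add fun ε hε => ?_
  obtain ⟨n, hn⟩ := hM.exists_finite_norm_add_le huv (‖φ + J v‖ + ‖v‖)
    (show 0 < ε / 3 by positivity)
  obtain ⟨z, hz1, hz⟩ := exists_norm_le_one_lt_apply_s15 (φ + J u) (show 0 < ε / 3 by positivity)
  let x : Fin (n + 1) → X := fun k => TopologicalSpace.denseSeq X k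
  obtain ⟨g, hg, hgw⟩ := exists_norm_le_forall_abs_sub_lt
    (fun o : Option (Fin (n + 1)) => o.elim z fun k => inclusionInDoubleDual ℝ X (x k)) (φ + J v)
    (show 0 < min (ε / 3) (1 / (n + 1 : ℝ)) by positivity)
  have hgz := (hgw none).trans_le (min_le_left _ _)
  have hf : ‖g - v + u‖ ≤ ‖g - v + v‖ + ε / 3 := by
    refine hn (g - v) ((norm_sub_le _ _).trans (by linarith)) fun k hk => ?_
    have := (hgw (some ⟨k, by omega⟩)).le.trans (min_le_right _ _)
    simpa [hφ, J, x] using this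
  rw [sub_add_cancel] at hf
  have h1 : z (g - v + u) ≤ ‖g - v + u‖ := by
    refine (le_abs_self _).trans ((z.le_opNorm _).trans ?_)
    exact mul_le_of_le_one_left (norm_nonneg _) hz1
  have h2 := (abs_lt.1 hgz).1
  simp only [Option.elim, add_apply, J, dual_def, map_add, map_sub] at h1 h2 hz
  linarith

open NormedSpace in
/-- Under (M*), the third dual is the `ℓ₁`-sum of the dual and the annihilator of `X`. -/
theorem PropertyMStar.norm_add_norm_le [TopologicalSpace.SeparableSpace X]
    (hM : PropertyMStar X) (u : X →L[ℝ] ℝ)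
    (φ : ((X →L[ℝ] ℝ) →L[ℝ] ℝ) →L[ℝ] ℝ) (hφ : ∀ x, φ (inclusionInDoubleDual ℝ X x) = 0) :
    ‖φ‖ + ‖u‖ ≤ ‖φ + inclusionInDoubleDual ℝ (X →L[ℝ] ℝ) u‖ := by
  rcases (norm_nonneg φ).eq_or_lt with h0 | h0
  · have : φ = 0 := norm_eq_zero.1 h0.symm
    subst this
    rw [norm_zero, zero_add, zero_add]
    exact ((inclusionInDoubleDualLi (E := X →L[ℝ] ℝ) ℝ).norm_map u).ge
  set s := ‖u‖ / ‖φ‖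
  have hs0 : 0 ≤ s := by positivity
  have hsφ : s * ‖φ‖ = ‖u‖ := div_mul_cancel₀ _ h0.ne'
  refine le_of_forall_pos_le_add fun ε hε => ?_
  have hδ : 0 < ε / (2 * (1 + s)) := by positivity
  obtain ⟨z, hz1, hz⟩ := exists_norm_le_one_lt_apply_s15 φ hδ
  obtain ⟨f, hf, hfz⟩ := exists_norm_le_forall_abs_sub_lt (fun _ : Unit => z) φ hδ
  have h1 : ‖s • f‖ ≤ ‖u‖ := by
    rw [norm_smul, Real.norm_of_nonneg hs0, ← hsφ]
    gcongr
  have h2 := hM.norm_add_inclusion_mono h1 φ hφ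
  have h3 := (le_abs_self _).trans
    ((φ + inclusionInDoubleDual ℝ (X →L[ℝ] ℝ) (s • f)).le_opNorm z)
  have h4 := mul_le_of_le_one_right
    (norm_nonneg (φ + inclusionInDoubleDual ℝ (X →L[ℝ] ℝ) (s • f))) hz1
  have h5 := (abs_lt.1 (hfz ())).1
  have h6 : φ z + s * z f ≤
      ‖φ + inclusionInDoubleDual ℝ (X →L[ℝ] ℝ) (s • f)‖ * ‖z‖ := by
    rwa [add_apply, dual_def, map_smul, smul_eq_mul] at h3
  have h7 : (1 + s) * (ε / (2 * (1 + s))) = ε / 2 := by field_simp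
  have h8 := mul_le_mul_of_nonneg_left (show φ z - ε / (2 * (1 + s)) ≤ z f by linarith) hs0
  have h9 := mul_le_mul_of_nonneg_left hz.le hs0
  linarith

open NormedSpace in
/-- Under (M*), finite families in `X` of norm at most `r` can be simultaneously moved by a
translate of an element of the bidual within norm slightly larger than `r`. -/
theorem PropertyMStar.exists_forall_norm_add_sub_lt [TopologicalSpace.SeparableSpace X]
    (hM : PropertyMStar X) {ι : Type*} [Fintype ι] (x : ι → X) {r ε : ℝ} (hx : ∀ i, ‖x i‖ ≤ r)
    (z : (X →L[ℝ] ℝ) →L[ℝ] ℝ) (hz : ‖z‖ ≤ r) (hε : 0 < ε) :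
    ∃ y : X, ∀ i, ‖inclusionInDoubleDual ℝ X (x i) + z - inclusionInDoubleDual ℝ X y‖ < r + ε := by
  have hr : 0 ≤ r := (norm_nonneg z).trans hz
  obtain ⟨_, ⟨y, rfl⟩, hy⟩ := exists_forall_norm_sub_lt_of_dual
    (LinearMap.range (inclusionInDoubleDual ℝ X).toLinearMap)
    (fun i => inclusionInDoubleDual ℝ X (x i) + z) hr hε (by
      intro φ hφ
      let u : ι → X →L[ℝ] ℝ := fun i => (φ i).comp (inclusionInDoubleDual ℝ X)
      let ψ : ι → ((X →L[ℝ] ℝ) →L[ℝ] ℝ) →L[ℝ] ℝ :=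
        fun i => φ i - inclusionInDoubleDual ℝ (X →L[ℝ] ℝ) (u i)
      have hn : ∀ i, ‖ψ i‖ + ‖u i‖ ≤ ‖φ i‖ := by
        intro i
        have := hM.norm_add_norm_le (u i) (ψ i) (by simp [ψ, u])
        rwa [sub_add_cancel] at this
      have hu : ∑ i, u i = 0 := by
        ext x
        simpa [u] using hφ _ ⟨x, rfl⟩
      have hzu : ∑ i, z (u i) = 0 := by rw [← map_sum, hu, map_zero]
      calc ∑ i, φ i (inclusionInDoubleDual ℝ X (x i) + z)
          = ∑ i, (u i (x i) + ψ i z) + ∑ i, z (u i) := by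
            rw [← Finset.sum_add_distrib]
            refine Finset.sum_congr rfl fun i _ => ?_
            simp [u, ψ]
            ring
        _ = ∑ i, (u i (x i) + ψ i z) := by rw [hzu, add_zero]
        _ ≤ ∑ i, r * ‖φ i‖ := Finset.sum_le_sum fun i _ => by
            have h1 := (le_abs_self _).trans ((u i).le_opNorm_of_le (hx i))
            have h2 := (le_abs_self _).trans ((ψ i).le_opNorm_of_le hz)
            nlinarith [hn i]
        _ = r * ∑ i, ‖φ i‖ := (Finset.mul_sum _ _ _).symm)
  exact ⟨y, hy⟩

open NormedSpace in
/-- A form of local reflexivity: an element of the bidual whose translates by finitely many points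
have norm at most `r` can be replaced by an element of `X` with the same value at `f`. -/
theorem exists_apply_eq_forall_norm_add_lt {ι : Type*} [Fintype ι] (x : ι → X) {r ε : ℝ}
    (hr : 0 ≤ r) (z : (X →L[ℝ] ℝ) →L[ℝ] ℝ)
    (hz : ∀ i, ‖inclusionInDoubleDual ℝ X (x i) + z‖ ≤ r) (f : X →L[ℝ] ℝ) (hε : 0 < ε) :
    ∃ y : X, f y = z f ∧ ∀ i, ‖x i + y‖ < r + ε := by
  obtain ⟨y₁, hy₁⟩ : ∃ y₁, f y₁ = z f := by
    by_cases hf : f = 0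
    · exact ⟨0, by simp [hf]⟩
    · obtain ⟨w, hw⟩ : ∃ w, f w ≠ 0 := by
        by_contra! h
        exact hf (ContinuousLinearMap.ext h)
      exact ⟨(z f / f w) • w, by simp [hw]⟩
  obtain ⟨y, hy, hlt⟩ := exists_forall_norm_sub_lt_of_dual (LinearMap.ker f.toLinearMap)
    (fun i => x i + y₁) hr hε (by
      intro φ hφ
      have hker : ∃ t : ℝ, ∑ i, φ i = t • f := by
        have : (∑ i, φ i).toLinearMap ∈ Submodule.span ℝ {f.toLinearMap} := by
          rw [← Set.range_const (ι := Unit) (c := f.toLinearMap)]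
          refine mem_span_of_iInf_ker_le_ker fun y hy => ?_
          have hy' : y ∈ LinearMap.ker f.toLinearMap := by simpa using hy
          simpa using hφ y hy'
        obtain ⟨t, ht⟩ := Submodule.mem_span_singleton.1 this
        exact ⟨t, ContinuousLinearMap.ext fun y => (LinearMap.congr_fun ht y).symm⟩
      obtain ⟨t, ht⟩ := hker
      have h1 : ∑ i, φ i y₁ = ∑ i, z (φ i) := by
        rw [← map_sum, ht, map_smul, ← hy₁]
        simpa using DFunLike.congr_fun ht y₁
      calc ∑ i, φ i (x i + y₁) = ∑ i, (inclusionInDoubleDual ℝ X (x i) + z) (φ i) := by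
            simp [Finset.sum_add_distrib, h1]
        _ ≤ ∑ i, r * ‖φ i‖ := Finset.sum_le_sum fun i _ =>
            (le_abs_self _).trans (ContinuousLinearMap.le_of_opNorm_le _ (hz i) _)
        _ = r * ∑ i, ‖φ i‖ := (Finset.mul_sum _ _ _).symm)
  have hy0 : f y = 0 := hy
  exact ⟨y₁ - y, by simp [hy₁, hy0], fun i => by simpa [add_sub_assoc] using hlt i⟩

open NormedSpace in
/-- In a non-reflexive space with (M*), a compact set in a ball of radius `r ≥ 1` can be translated
along a nearly normalised vector and its opposite without increasing the norm much. -/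
theorem PropertyMStar.exists_norm_add_smul_le [CompleteSpace X]
    [TopologicalSpace.SeparableSpace X] (hM : PropertyMStar X) (hX : ¬ IsReflexive X)
    {K : Set X} (hK : IsCompact K) {r ε : ℝ} (hr : 1 ≤ r) (hKr : ∀ k ∈ K, ‖k‖ ≤ r) (hε : 0 < ε) :
    ∃ y : X, 3 / 4 ≤ ‖y‖ ∧ ∀ k ∈ K, ∀ t : ℝ, |t| ≤ 1 → ‖k + t • y‖ ≤ r + ε := by
  have hclosed : IsClosed
      (LinearMap.range (inclusionInDoubleDual ℝ X).toLinearMap : Set ((X →L[ℝ] ℝ) →L[ℝ] ℝ)) := by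
    have := (inclusionInDoubleDualLi (E := X) ℝ).isometry.isClosedEmbedding.isClosed_range
    exact this
  obtain ⟨z, -, hz1, hz⟩ := riesz_lemma_of_lt_one (𝕜 := ℝ) hclosed
    (by simpa [IsReflexive, Function.Surjective] using hX) (show (7 / 8 : ℝ) < 1 by norm_num)
  have hKK : IsCompact (K ∪ (-K)) := hK.union hK.neg
  obtain ⟨S, hSK, hSfin, hS⟩ := hKK.finite_cover_balls (show 0 < ε / 3 by positivity)
  have := hSfin.fintype
  have hSr : ∀ i : S, ‖(i : X)‖ ≤ r := by
    intro i
    rcases hSK i.2 with h | h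
    · exact hKr _ h
    · simpa using hKr _ h
  obtain ⟨y₀, hy₀⟩ := hM.exists_forall_norm_add_sub_lt (fun i : S => (i : X)) hSr z (by linarith)
    (show 0 < ε / 3 by positivity)
  obtain ⟨f, hf1, hf⟩ := exists_norm_le_one_lt_apply_s15 (z - inclusionInDoubleDual ℝ X y₀)
    (show (0 : ℝ) < 1 / 8 by norm_num)
  obtain ⟨y, hyf, hy⟩ := exists_apply_eq_forall_norm_add_lt (fun i : S => (i : X))
    (show 0 ≤ r + ε / 3 by linarith) (z - inclusionInDoubleDual ℝ X y₀)
    (fun i => by rw [← add_sub_assoc]; exact (hy₀ i).le) f (show 0 < ε / 3 by positivity)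
  have key : ∀ k ∈ K ∪ (-K), ‖k + y‖ ≤ r + ε := by
    intro k hk
    obtain ⟨s, hs, hks⟩ := Set.mem_iUnion₂.1 (hS hk)
    rw [Metric.mem_ball, dist_eq_norm] at hks
    have h1 := norm_add_le (k - s) (s + y)
    rw [← add_assoc, sub_add_cancel] at h1
    linarith [hy ⟨s, hs⟩]
  refine ⟨y, ?_, fun k hk t ht => ?_⟩
  · have h1 := hz _ ⟨y₀, rfl⟩
    have h2 := (le_abs_self _).trans (f.le_opNorm y)
    have h3 := mul_le_of_le_one_left (norm_nonneg y) hf1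
    have h4 : (7 / 8 : ℝ) ≤ ‖z - inclusionInDoubleDual ℝ X y₀‖ := h1
    linarith
  · have h1 := key k (Or.inl hk)
    have h2 := key (-k) (Or.inr (by simpa using hk))
    rw [show -k + y = -(k - y) by abel, norm_neg] at h2
    obtain ⟨h3, h4⟩ := abs_le.1 ht
    have h5 : k + t • y = ((1 + t) / 2) • (k + y) + ((1 - t) / 2) • (k - y) := by module
    rw [h5]
    refine (norm_add_le _ _).trans ?_
    rw [norm_smul, norm_smul, Real.norm_of_nonneg (by linarith), Real.norm_of_nonneg (by linarith)]
    nlinarith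

end MStar

section CZero

variable {X : Type*} [NormedAddCommGroup X] [NormedSpace ℝ X]

/-- The sequence of translated segments generated by a choice `y n K` of a new direction for the
set `K` at stage `n`. -/
def segmentSums (y : ℕ → Set X → X) : ℕ → Set X
  | 0 => {0}
  | n + 1 => (fun p : X × ℝ => p.1 + p.2 • y n (segmentSums y n)) ''
      (segmentSums y n ×ˢ Set.Icc (-1) 1)

/-- If compact sets in balls of radius `r ≥ 1` can be extended by segments in nearly normalised
directions, then there is a seminormalised sequence with an upper `c₀`-estimate. -/
theorem exists_seq_norm_sum_le
    (h : ∀ (K : Set X) (r ε : ℝ), IsCompact K → 1 ≤ r → (∀ k ∈ K, ‖k‖ ≤ r) → 0 < ε →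
      ∃ y : X, 3 / 4 ≤ ‖y‖ ∧ ∀ k ∈ K, ∀ t : ℝ, |t| ≤ 1 → ‖k + t • y‖ ≤ r + ε) :
    ∃ x : ℕ → X, (∀ n, 3 / 4 ≤ ‖x n‖) ∧ ∀ (F : Finset ℕ) (a : ℕ → ℝ), (∀ i ∈ F, |a i| ≤ 1) →
      ‖∑ i ∈ F, a i • x i‖ ≤ 5 / 4 := by
  let r : ℕ → ℝ := fun n => 5 / 4 - 1 / 4 / (n + 1)
  have hr1 : ∀ n, 1 ≤ r n := by
    intro n
    have : (1 / 4 : ℝ) / (n + 1) ≤ 1 / 4 := div_le_self (by norm_num) (by simp)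
    simp only [r]
    linarith
  have hr2 : ∀ n, r n ≤ 5 / 4 := by
    intro n
    have : 0 ≤ (1 / 4 : ℝ) / (n + 1) := by positivity
    simp only [r]
    linarith
  have hr3 : ∀ n, r n < r (n + 1) := by
    intro n
    have : (1 / 4 : ℝ) / ((n + 1 : ℕ) + 1) < 1 / 4 / (n + 1) := by
      gcongr
      simp
    simp only [r]
    linarith
  have hstep : ∀ (n : ℕ) (K : Set X), IsCompact K ∧ (∀ k ∈ K, ‖k‖ ≤ r n) →
      ∃ y : X, 3 / 4 ≤ ‖y‖ ∧ ∀ k ∈ K, ∀ t : ℝ, |t| ≤ 1 → ‖k + t • y‖ ≤ r (n + 1) := by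
    rintro n K ⟨hK, hKr⟩
    simpa using h K (r n) (r (n + 1) - r n) hK (hr1 n) hKr (sub_pos.2 (hr3 n))
  choose! y hy1 hy2 using hstep
  let K := segmentSums y
  have hK : ∀ n, IsCompact (K n) ∧ ∀ k ∈ K n, ‖k‖ ≤ r n := by
    intro n
    induction n with
    | zero => exact ⟨isCompact_singleton, by simp [K, segmentSums, r]; norm_num⟩
    | succ n ih =>
      refine ⟨(ih.1.prod isCompact_Icc).image (by fun_prop), ?_⟩
      rintro _ ⟨⟨k, t⟩, ⟨hk, ht⟩, rfl⟩
      exact hy2 n (K n) ih k hk t (abs_le.2 ht)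
  let x : ℕ → X := fun n => y n (K n)
  have hsum : ∀ (a : ℕ → ℝ), (∀ i, |a i| ≤ 1) → ∀ n, ∑ i ∈ Finset.range n, a i • x i ∈ K n := by
    intro a ha n
    induction n with
    | zero => simp [K, segmentSums]
    | succ n ih =>
      rw [Finset.sum_range_succ]
      exact ⟨(_, a n), ⟨ih, abs_le.1 (ha n)⟩, rfl⟩
  refine ⟨x, fun n => hy1 n (K n) (hK n), fun F a ha => ?_⟩
  obtain ⟨N, hN⟩ := F.exists_nat_subset_range
  have h1 := hsum (fun i => if i ∈ F then a i else 0)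
    (fun i => by by_cases hi : i ∈ F <;> simp [hi, ha]) N
  have h2 : ∑ i ∈ Finset.range N, (if i ∈ F then a i else 0) • x i = ∑ i ∈ F, a i • x i := by
    simp_rw [ite_smul, zero_smul]
    rw [Finset.sum_ite_mem, Finset.inter_eq_right.2 hN]
  rw [h2] at h1
  exact ((hK N).2 _ h1).trans (hr2 N)

/-- A seminormalised sequence with an upper `c₀`-estimate of constant close to one spans a copy of
`c₀`. -/
theorem embedsIso_c0_of_norm_sum_le [CompleteSpace X] (x : ℕ → X) (hx : ∀ n, 3 / 4 ≤ ‖x n‖)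
    (h : ∀ (F : Finset ℕ) (a : ℕ → ℝ), (∀ i ∈ F, |a i| ≤ 1) → ‖∑ i ∈ F, a i • x i‖ ≤ 5 / 4) :
    EmbedsIso C₀(ℕ, ℝ) X := by
  have hscale : ∀ (F : Finset ℕ) (a : ℕ → ℝ) (M : ℝ), 0 < M → (∀ i ∈ F, |a i| ≤ M) →
      ‖∑ i ∈ F, a i • x i‖ ≤ 5 / 4 * M := by
    intro F a M hM ha
    have h1 := h F (fun i => a i / M) fun i hi => by
      rw [abs_div, abs_of_pos hM]
      exact (div_le_one hM).2 (ha i hi)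
    have h2 : ∑ i ∈ F, a i • x i = M • ∑ i ∈ F, (a i / M) • x i := by
      rw [Finset.smul_sum]
      exact Finset.sum_congr rfl fun i _ => by rw [smul_smul, mul_div_cancel₀ _ hM.ne']
    rw [h2, norm_smul, Real.norm_of_nonneg hM.le]
    nlinarith
  have hcoord : ∀ (a : C₀(ℕ, ℝ)) (i : ℕ), |a i| ≤ ‖a‖ := fun a i => a.toBCF.norm_coe_le_norm i
  have hsummable : ∀ a : C₀(ℕ, ℝ), Summable fun i => a i • x i := by
    intro a
    rw [summable_iff_vanishing_norm]
    intro ε hε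
    have ha : Tendsto a atTop (nhds 0) := by
      have := zero_at_infty a
      rwa [cocompact_eq_cofinite, Nat.cofinite_eq_atTop] at this
    obtain ⟨N, hN⟩ := Metric.tendsto_atTop.1 ha (ε / 2) (by positivity)
    refine ⟨Finset.range N, fun t ht => ?_⟩
    have := hscale t a (ε / 2) (by positivity) fun i hi => by
      have hiN : N ≤ i := by
        by_contra hlt
        exact Finset.disjoint_left.1 ht hi (Finset.mem_range.2 (not_le.1 hlt))
      simpa using (hN i hiN).le
    linarith
  have hbound : ∀ (a : C₀(ℕ, ℝ)), ‖∑' i, a i • x i‖ ≤ 5 / 4 * ‖a‖ := by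
    intro a
    rcases (norm_nonneg a).eq_or_lt with h0 | h0
    · have : a = 0 := norm_eq_zero.1 h0.symm
      simp [this]
    · exact le_of_tendsto (hsummable a).hasSum.norm
        (Eventually.of_forall fun F => hscale F a _ h0 fun i _ => hcoord a i)
  have hlower : ∀ (a : C₀(ℕ, ℝ)) (j : ℕ),
      3 / 2 * |a j| ≤ ‖∑' i, a i • x i‖ + 5 / 4 * ‖a‖ := by
    intro a j
    rcases (norm_nonneg a).eq_or_lt with h0 | h0
    · have : a = 0 := norm_eq_zero.1 h0.symm
      simp [this]
    have hlim : ‖(2 * a j) • x j - ∑' i, a i • x i‖ ≤ 5 / 4 * ‖a‖ := by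
      refine le_of_tendsto ((hsummable a).hasSum.const_sub ((2 * a j) • x j)).norm ?_
      filter_upwards [eventually_ge_atTop {j}] with F hF
      have hj : j ∈ F := hF (Finset.mem_singleton_self j)
      have h1 := hscale F (fun i => if i = j then a i else -a i) ‖a‖ h0 fun i _ => by
        split_ifs
        · exact hcoord a i
        · rw [abs_neg]
          exact hcoord a i
      refine le_of_eq_of_le (congrArg norm ?_) h1
      rw [← Finset.add_sum_erase F _ hj, ← Finset.add_sum_erase F _ hj, if_pos rfl]
      have h2 : ∑ i ∈ F.erase j, (if i = j then a i else -a i) • x i =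
          -∑ i ∈ F.erase j, a i • x i := by
        rw [← Finset.sum_neg_distrib]
        exact Finset.sum_congr rfl fun i hi => by
          rw [if_neg (Finset.ne_of_mem_erase hi), neg_smul]
      rw [h2]
      module
    have h1 := norm_add_le (∑' i, a i • x i) ((2 * a j) • x j - ∑' i, a i • x i)
    rw [add_sub_cancel, norm_smul, Real.norm_eq_abs, abs_mul, abs_two] at h1
    nlinarith [hx j, abs_nonneg (a j)]
  let T : C₀(ℕ, ℝ) →ₗ[ℝ] X :=
    { toFun := fun a => ∑' i, a i • x i
      map_add' := fun a b => by
        simp only [ZeroAtInftyContinuousMap.add_apply, add_smul]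
        exact (hsummable a).tsum_add (hsummable b)
      map_smul' := fun c a => by
        simp only [ZeroAtInftyContinuousMap.smul_apply, smul_assoc, RingHom.id_apply]
        exact (hsummable a).tsum_const_smul c }
  have hT : ∀ a, 1 / 4 * ‖a‖ ≤ ‖T a‖ := by
    intro a
    have h1 : ‖a‖ ≤ (‖T a‖ + 5 / 4 * ‖a‖) / (3 / 2) := by
      refine (BoundedContinuousFunction.norm_le (f := a.toBCF) (by positivity)).2 fun j => ?_
      rw [le_div_iff₀ (by norm_num), mul_comm]
      exact hlower a j
    linarith
  refine ⟨T.mkContinuous (5 / 4) hbound, ?_, 1 / 4, by norm_num, hT⟩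
  refine (injective_iff_map_eq_zero _).2 fun a ha => ?_
  have h1 := hT a
  have h2 : T a = 0 := ha
  rw [h2, norm_zero] at h1
  exact norm_le_zero_iff.1 (by linarith)

end CZero

theorem stmt15 (X : Type*) [NormedAddCommGroup X] [NormedSpace ℝ X] [CompleteSpace X]
    [TopologicalSpace.SeparableSpace X]
    (hM : PropertyMStar X) (hc : ¬ EmbedsIso C₀(ℕ, ℝ) X) :
    IsReflexive X := by
  by_contra hX
  obtain ⟨x, hx, hsum⟩ := exists_seq_norm_sum_le (X := X)
    fun K r ε hK hr hKr hε => hM.exists_norm_add_smul_le hX hK hr hKr hε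
  exact hc (embedsIso_c0_of_norm_sum_le x hx hsum)
end

section
/- Let X be a separable real Banach space whose dual X* has Property(M*). If X is reflexive, then X has the fixed point property and X* has the fixed point property. -/
open Filter Topology ZeroAtInfty

/-- Property (M) phrased with eventual norm bounds instead of upper limits. -/
def EventualPropertyM (E : Type*) [NormedAddCommGroup E] [NormedSpace ℝ E] : Prop :=
  ∀ x : ℕ → E, WeakNull x → ∀ u v : E, ‖u‖ ≤ ‖v‖ → ∀ b c : ℝ, b < c →
    (∀ᶠ n in atTop, ‖x n + v‖ ≤ b) → ∀ᶠ n in atTop, ‖x n + u‖ < c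

/-- Every bounded sequence has a weakly convergent subsequence. -/
def BoundedWeaklySeqCompact (E : Type*) [NormedAddCommGroup E] [NormedSpace ℝ E] : Prop :=
  ∀ (x : ℕ → E) (R : ℝ), (∀ n, ‖x n‖ ≤ R) → ∃ z : E, ∃ φ : ℕ → ℕ, StrictMono φ ∧
    ∀ f : E →L[ℝ] ℝ, Tendsto (fun n => f (x (φ n))) atTop (𝓝 (f z))

section

variable {E : Type*} [NormedAddCommGroup E] [NormedSpace ℝ E]

theorem WeakNull.comp_strictMono {x : ℕ → E} (hx : WeakNull x) {φ : ℕ → ℕ} (hφ : StrictMono φ) :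
    WeakNull (x ∘ φ) :=
  fun f => (hx f).comp hφ.tendsto_atTop

/-- Sequential Banach-Alaoglu, stated pointwise. -/
theorem exists_subseq_tendsto_apply [TopologicalSpace.SeparableSpace E]
    (f : ℕ → (E →L[ℝ] ℝ)) (R : ℝ) (hf : ∀ n, ‖f n‖ ≤ R) :
    ∃ g : E →L[ℝ] ℝ, ∃ φ : ℕ → ℕ, StrictMono φ ∧
      ∀ x, Tendsto (fun n => f (φ n) x) atTop (𝓝 (g x)) := by
  obtain ⟨g, -, φ, hφ, hg⟩ := WeakDual.isSeqCompact_closedBall ℝ E 0 R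
    (x := fun n => StrongDual.toWeakDual (f n)) (fun n => by simpa using hf n)
  exact ⟨WeakDual.toStrongDual g, φ, hφ, fun x => ((WeakDual.eval_continuous x).tendsto g).comp hg⟩

theorem eventually_norm_add_lt_of_limsup_le {F : Type*} [SeminormedAddCommGroup F]
    {x : ℕ → F} {u v : F} {b c : ℝ}
    (h : limsup (fun n => ‖x n + u‖) atTop ≤ limsup (fun n => ‖x n + v‖) atTop)
    (hbc : b < c) (hb : ∀ᶠ n in atTop, ‖x n + v‖ ≤ b) : ∀ᶠ n in atTop, ‖x n + u‖ < c := by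
  have hv : limsup (fun n => ‖x n + v‖) atTop ≤ b :=
    limsup_le_of_le (isCoboundedUnder_le_of_le atTop (x := 0) fun n => norm_nonneg _) hb
  refine eventually_lt_of_limsup_lt (h.trans_lt (hv.trans_lt hbc)) ⟨b + ‖u - v‖, eventually_map.2 ?_⟩
  filter_upwards [hb] with n hn
  calc ‖x n + u‖ = ‖(x n + v) + (u - v)‖ := by congr 1; abel
    _ ≤ ‖x n + v‖ + ‖u - v‖ := norm_add_le _ _
    _ ≤ b + ‖u - v‖ := by gcongr

theorem PropertyMStar.eventualPropertyM_dual (hM : PropertyMStar E) :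
    EventualPropertyM (E →L[ℝ] ℝ) := fun f hf u v huv _ _ hbc hb =>
  eventually_norm_add_lt_of_limsup_le
    (hM f (fun x => hf (NormedSpace.inclusionInDoubleDual ℝ E x)) u v huv) hbc hb

/-- Property (M*) of the dual implies property (M) of the space. -/
theorem PropertyMStar.eventualPropertyM [TopologicalSpace.SeparableSpace E]
    (hM : PropertyMStar E) : EventualPropertyM E := by
  intro x hx u v huv b c hbc hb
  by_contra hcon
  have hfreq : ∃ᶠ n in atTop, c ≤ ‖x n + u‖ ∧ ‖x n + v‖ ≤ b := by
    rw [not_eventually] at hcon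
    exact (hcon.and_eventually hb).mono fun n hn => ⟨not_lt.1 hn.1, hn.2⟩
  obtain ⟨φ, hφ, hφx⟩ := extraction_of_frequently_atTop hfreq
  choose f hf1 hfx using fun n => exists_dual_vector'' ℝ (x (φ n) + u)
  obtain ⟨g, ψ, hψ, hg⟩ := exists_subseq_tendsto_apply f 1 hf1
  obtain ⟨k, hk1, hkv⟩ := exists_dual_vector'' ℝ v
  simp only [RCLike.ofReal_real_eq_id, id_eq] at hfx hkv
  have hb0 : 0 ≤ b := (norm_nonneg _).trans (hφx 0).2
  have hkg : ‖‖g‖ • k‖ ≤ ‖g‖ := by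
    rw [norm_smul, norm_norm]
    exact mul_le_of_le_one_right (norm_nonneg _) hk1
  have hnull : WeakStarNull fun n => f (ψ n) - g := fun y => by
    simpa using (hg y).sub_const (g y)
  set ε : ℝ := (c - b) / (2 * (b + 1)) with hε
  have hε0 : 0 < ε := div_pos (by linarith) (by linarith)
  have hbound : ∀ᶠ n in atTop, ‖f (ψ n) - g + ‖g‖ • k‖ < 1 + ε :=
    eventually_norm_add_lt_of_limsup_le (hM _ hnull (‖g‖ • k) g hkg) (b := 1) (by linarith)
      (.of_forall fun n => by simpa using hf1 (ψ n))
  have hx' := (hx.comp_strictMono hφ).comp_strictMono hψ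
  have hlim : Tendsto (fun n => (1 + ε) * b + (g (x (φ (ψ n))) - ‖g‖ * k (x (φ (ψ n)))
      + f (ψ n) u - f (ψ n) v + g v - ‖g‖ * k v)) atTop
      (𝓝 ((1 + ε) * b + (0 - ‖g‖ * 0 + g u - g v + g v - ‖g‖ * k v))) :=
    tendsto_const_nhds.add ((((((hx' g).sub ((hx' k).const_mul _)).add (hg u)).sub
      (hg v)).add_const _).sub_const _)
  have hle : c ≤ (1 + ε) * b + (0 - ‖g‖ * 0 + g u - g v + g v - ‖g‖ * k v) := by
    refine ge_of_tendsto hlim ?_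
    filter_upwards [hbound] with n hn
    have h1 : (f (ψ n) - g + ‖g‖ • k) (x (φ (ψ n)) + v) ≤ (1 + ε) * b :=
      (le_abs_self _).trans ((ContinuousLinearMap.le_opNorm _ _).trans
        (mul_le_mul hn.le (hφx (ψ n)).2 (norm_nonneg _) (by linarith)))
    have h2 := hfx (ψ n)
    have h3 := (hφx (ψ n)).1
    simp only [add_apply, sub_apply, smul_apply, map_add, smul_eq_mul] at h1 h2
    linarith
  have hgu : g u ≤ ‖g‖ * ‖v‖ :=
    (le_abs_self _).trans ((g.le_opNorm u).trans (by gcongr))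
  have hεb : ε * b < c - b := by
    rw [hε, div_mul_eq_mul_div, div_lt_iff₀ (by linarith)]
    nlinarith
  rw [hkv] at hle
  linarith

/-- The dual of a separable reflexive space is separable. -/
theorem IsReflexive.separableSpace_dual [TopologicalSpace.SeparableSpace E]
    (hr : IsReflexive E) : TopologicalSpace.SeparableSpace (E →L[ℝ] ℝ) := by
  choose f hf1 hfx using fun n => exists_dual_vector'' ℝ (TopologicalSpace.denseSeq E n)
  simp only [RCLike.ofReal_real_eq_id, id_eq] at hfx
  set S : Submodule ℝ (E →L[ℝ] ℝ) := (Submodule.span ℝ (Set.range f)).topologicalClosure with hS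
  have htop : (S : Set (E →L[ℝ] ℝ)) = Set.univ := by
    by_contra hne
    obtain ⟨p, hp⟩ := (Set.ne_univ_iff_exists_notMem _).1 hne
    obtain ⟨Φ, r, hΦS, hΦp⟩ := geometric_hahn_banach_closed_point S.convex
      (Submodule.isClosed_topologicalClosure _) hp
    have hr0 : 0 < r := by simpa using hΦS 0 S.zero_mem
    have hzero : ∀ q ∈ S, Φ q = 0 := by
      intro q hq
      by_contra hq0
      have := hΦS ((r / Φ q) • q) (S.smul_mem _ hq)
      rw [map_smul, smul_eq_mul, div_mul_cancel₀ _ hq0] at this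
      exact lt_irrefl _ this
    obtain ⟨x, rfl⟩ := hr Φ
    have hfx0 : ∀ n, f n x = 0 := fun n =>
      hzero (f n) (Submodule.le_topologicalClosure _ (Submodule.subset_span ⟨n, rfl⟩))
    have hx0 : x = 0 := by
      by_contra hx
      have hx' : 0 < ‖x‖ / 2 := by positivity
      obtain ⟨n, hn⟩ := (TopologicalSpace.denseRange_denseSeq E).exists_dist_lt x hx'
      rw [dist_eq_norm] at hn
      have h1 : ‖TopologicalSpace.denseSeq E n‖ ≤ ‖x - TopologicalSpace.denseSeq E n‖ := by
        calc ‖TopologicalSpace.denseSeq E n‖ = -f n (x - TopologicalSpace.denseSeq E n) := by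
              rw [map_sub, hfx0, hfx]; ring
          _ ≤ ‖f n‖ * ‖x - TopologicalSpace.denseSeq E n‖ :=
              (neg_le_abs _).trans ((f n).le_opNorm _)
          _ ≤ ‖x - TopologicalSpace.denseSeq E n‖ :=
              mul_le_of_le_one_left (norm_nonneg _) (hf1 n)
      have h2 := norm_sub_norm_le x (TopologicalSpace.denseSeq E n)
      linarith
    simp [hx0] at hΦp
    linarith
  have hsep : TopologicalSpace.IsSeparable (S : Set (E →L[ℝ] ℝ)) := by
    rw [hS, Submodule.topologicalClosure_coe]
    exact ((Set.countable_range f).isSeparable.span).closure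
  rw [htop] at hsep
  exact TopologicalSpace.isSeparable_univ_iff.1 hsep

theorem IsReflexive.boundedWeaklySeqCompact [TopologicalSpace.SeparableSpace E]
    (hr : IsReflexive E) : BoundedWeaklySeqCompact E := by
  have := hr.separableSpace_dual
  intro x R hx
  obtain ⟨Φ, φ, hφ, hΦ⟩ := exists_subseq_tendsto_apply
    (fun n => NormedSpace.inclusionInDoubleDual ℝ E (x n)) R
    (fun n => (NormedSpace.double_dual_bound ℝ E (x n)).trans (hx n))
  obtain ⟨z, rfl⟩ := hr Φ
  exact ⟨z, φ, hφ, hΦ⟩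

theorem IsReflexive.boundedWeaklySeqCompact_dual [TopologicalSpace.SeparableSpace E]
    (hr : IsReflexive E) : BoundedWeaklySeqCompact (E →L[ℝ] ℝ) := by
  intro f R hf
  obtain ⟨g, φ, hφ, hg⟩ := exists_subseq_tendsto_apply f R hf
  refine ⟨g, φ, hφ, fun Φ => ?_⟩
  obtain ⟨x, rfl⟩ := hr Φ
  exact hg x

/-- A closed convex set contains the weak limits of its sequences. -/
theorem Convex.mem_of_weak_tendsto {C : Set E} (hC : Convex ℝ C) (hcl : IsClosed C)
    {x : ℕ → E} {z : E} (hx : ∀ᶠ n in atTop, x n ∈ C)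
    (hz : ∀ f : E →L[ℝ] ℝ, Tendsto (fun n => f (x n)) atTop (𝓝 (f z))) : z ∈ C := by
  by_contra hzC
  obtain ⟨f, r, hfC, hfz⟩ := geometric_hahn_banach_closed_point hC hcl hzC
  exact hfz.not_ge (le_of_tendsto (hz f) (hx.mono fun n hn => (hfC _ hn).le))

/-- A weakly null sequence of asymptotically norm one vectors cannot be asymptotically absorbed by
the unit ball when bounded sequences have weakly convergent subsequences. -/
theorem BoundedWeaklySeqCompact.false_of_absorbed [TopologicalSpace.SeparableSpace E]
    (hE : BoundedWeaklySeqCompact E) {w : ℕ → E} (hw : WeakNull w)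
    (hw1 : Tendsto (fun n => ‖w n‖) atTop (𝓝 1))
    (habs : ∀ u : E, ‖u‖ < 1 → ∀ c > 1, ∀ᶠ n in atTop, ‖w n + u‖ < c) : False := by
  choose f hf1 hfw using fun n => exists_dual_vector'' ℝ (w n)
  simp only [RCLike.ofReal_real_eq_id, id_eq] at hfw
  obtain ⟨f₀, φ, hφ, hf₀⟩ := exists_subseq_tendsto_apply f 1 hf1
  set g : ℕ → (E →L[ℝ] ℝ) := fun n => f (φ n) - f₀ with hg
  have hgnull : ∀ x, Tendsto (fun n => g n x) atTop (𝓝 0) := fun x => by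
    simpa [hg] using (hf₀ x).sub_const (f₀ x)
  have hv : WeakNull (w ∘ φ) := hw.comp_strictMono hφ
  have hgv : Tendsto (fun n => g n (w (φ n))) atTop (𝓝 1) := by
    simpa [hg, hfw] using (hw1.comp hφ.tendsto_atTop).sub (hv f₀)
  let P : ℕ → Finset ℕ → Prop := fun k F => ∃ s : E, ‖s‖ < 2 - (1 / 2) ^ k ∧
    ∀ i ∈ F, 1 / 2 + (1 / 2) ^ k / 4 ≤ g i s
  have hstep : ∀ k F, P k F → ∃ n ≥ k, P (k + 1) (insert n F) := by
    rintro k F ⟨s, hs, hF⟩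
    have hk0 : (0 : ℝ) < (1 / 2) ^ k := by positivity
    have hk1 : ((1 : ℝ) / 2) ^ k ≤ 1 := pow_le_one₀ (by norm_num) (by norm_num)
    have hks : ((1 : ℝ) / 2) ^ (k + 1) = (1 / 2) ^ k / 2 := by ring
    set r : ℝ := 2 - (1 / 2) ^ k with hr
    have hr1 : 1 ≤ r := by linarith
    have hr0 : 0 < r := by linarith
    have hsr : ‖r⁻¹ • s‖ < 1 := by
      rw [norm_smul, norm_inv, Real.norm_of_nonneg hr0.le, inv_mul_lt_one₀ hr0]
      exact hs
    have h1 := hφ.tendsto_atTop.eventually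
      (habs _ hsr ((2 - (1 / 2) ^ (k + 1)) / r) ((one_lt_div hr0).2 (by linarith)))
    have h2 := (hgnull s).eventually (lt_mem_nhds (show (-1 / 8 : ℝ) < 0 by norm_num))
    have h3 := hgv.eventually (lt_mem_nhds (show (7 / 8 : ℝ) < 1 by norm_num))
    have h4 : ∀ᶠ n in atTop, ∀ i ∈ F, -((1 / 2) ^ k / 8) < g i (w (φ n)) :=
      (eventually_all_finset F).2 fun i _ => (hv (g i)).eventually (lt_mem_nhds (by linarith))
    obtain ⟨n, ⟨⟨⟨h1, h2⟩, h3⟩, h4⟩, hn⟩ :=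
      ((((h1.and h2).and h3).and h4).and (eventually_ge_atTop k)).exists
    refine ⟨n, hn, s + w (φ n), ?_, ?_⟩
    · have hrw : ‖r • w (φ n) + s‖ < 2 - (1 / 2) ^ (k + 1) := by
        have : r • w (φ n) + s = r • (w (φ n) + r⁻¹ • s) := by
          rw [smul_add, smul_inv_smul₀ hr0.ne']
        rw [this, norm_smul, Real.norm_of_nonneg hr0.le]
        rwa [lt_div_iff₀' hr0] at h1
      have hcomb : s + w (φ n) = r⁻¹ • (r • w (φ n) + s) + (1 - r⁻¹) • s := by
        rw [smul_add, inv_smul_smul₀ hr0.ne', sub_smul, one_smul]; abel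
      have hri0 : 0 < r⁻¹ := inv_pos.2 hr0
      have hri1 : r⁻¹ ≤ 1 := inv_le_one_of_one_le₀ hr1
      calc ‖s + w (φ n)‖ ≤ r⁻¹ * ‖r • w (φ n) + s‖ + (1 - r⁻¹) * ‖s‖ := by
            rw [hcomb]
            refine (norm_add_le _ _).trans_eq ?_
            rw [norm_smul, norm_smul, Real.norm_of_nonneg hri0.le,
              Real.norm_of_nonneg (sub_nonneg.2 hri1)]
        _ < 2 - (1 / 2) ^ (k + 1) := by
            have hs' : ‖s‖ ≤ 2 - (1 / 2) ^ (k + 1) := by linarith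
            nlinarith [mul_lt_mul_of_pos_left hrw hri0,
              mul_le_mul_of_nonneg_left hs' (sub_nonneg.2 hri1)]
    · intro i hi
      rw [map_add]
      rcases Finset.mem_insert.1 hi with rfl | hi
      · linarith
      · linarith [hF i hi, h4 i hi]
  have hbase : P 0 ∅ := ⟨0, by norm_num, by simp⟩
  choose! N hNge hNP using hstep
  let G : ℕ → Finset ℕ := fun k => Nat.rec ∅ (fun k F => insert (N k F) F) k
  have hG : ∀ k, P k (G k) := fun k => by
    induction k with
    | zero => exact hbase
    | succ k ih => exact hNP k (G k) ih
  have hGmono : Monotone G := monotone_nat_of_le_succ fun k => Finset.subset_insert _ _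
  choose s hs hsg using hG
  obtain ⟨z, ψ, hψ, hz⟩ := hE s 2 fun k => (hs k).le.trans (by
    linarith [show (0 : ℝ) < (1 / 2) ^ k by positivity])
  have hfreq : ∃ᶠ n in atTop, 1 / 2 ≤ g n z := by
    refine frequently_atTop.2 fun k => ⟨N k (G k), hNge k _ ⟨s k, hs k, hsg k⟩, ?_⟩
    refine ge_of_tendsto (hz (g (N k (G k)))) ?_
    filter_upwards [eventually_ge_atTop (k + 1)] with j hj
    have hmem : N k (G k) ∈ G (ψ j) :=
      hGmono (hj.trans (hψ.id_le j)) (Finset.mem_insert_self _ _)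
    linarith [hsg (ψ j) _ hmem, show (0 : ℝ) < (1 / 2) ^ ψ j by positivity]
  obtain ⟨n, h1, h2⟩ := (hfreq.and_eventually
    ((hgnull z).eventually (gt_mem_nhds (show (0 : ℝ) < 1 / 2 by norm_num)))).exists
  linarith

/-- A nonempty chain of nonempty bounded closed convex sets has nonempty intersection. -/
theorem BoundedWeaklySeqCompact.nonempty_sInter [TopologicalSpace.SeparableSpace E]
    (hE : BoundedWeaklySeqCompact E) {c : Set (Set E)} (hc : IsChain (· ⊆ ·) c)
    (hcne : c.Nonempty) (hne : ∀ D ∈ c, D.Nonempty) (hcl : ∀ D ∈ c, IsClosed D)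
    (hbdd : ∀ D ∈ c, Bornology.IsBounded D) (hconv : ∀ D ∈ c, Convex ℝ D) :
    (⋂₀ c).Nonempty := by
  have : SecondCountableTopology E := UniformSpace.secondCountable_of_separable E
  obtain ⟨T, hTcount, hTc, hTU⟩ := TopologicalSpace.isOpen_sUnion_countable (compl '' c)
    (by rintro _ ⟨D, hD, rfl⟩; exact (hcl D hD).isOpen_compl)
  obtain ⟨D₀, hD₀⟩ := hcne
  have hT'count : (insert D₀ (compl '' T)).Countable := (hTcount.image _).insert _
  obtain ⟨d, hd⟩ := hT'count.exists_eq_range (Set.insert_nonempty _ _)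
  have hdc : ∀ n, d n ∈ c := fun n => by
    have : d n ∈ insert D₀ (compl '' T) := hd ▸ Set.mem_range_self n
    rcases this with h | ⟨U, hU, h⟩
    · rwa [h]
    · obtain ⟨D, hD, rfl⟩ := hTc hU
      rwa [← h, compl_compl]
  have hfin : ∀ n, ∃ D ∈ c, ∀ i ≤ n, D ⊆ d i := fun n => by
    induction n with
    | zero => exact ⟨d 0, hdc 0, fun i hi => by rw [Nat.le_zero.1 hi]⟩
    | succ n ih =>
      obtain ⟨D, hD, hDi⟩ := ih
      rcases hc.total hD (hdc (n + 1)) with h | h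
      · refine ⟨D, hD, fun i hi => ?_⟩
        rcases Nat.le_succ_iff.1 hi with hi | rfl
        exacts [hDi i hi, h]
      · refine ⟨d (n + 1), hdc _, fun i hi => ?_⟩
        rcases Nat.le_succ_iff.1 hi with hi | rfl
        exacts [h.trans (hDi i hi), subset_rfl]
  choose D hDc hDd using hfin
  choose x hx using fun n => hne (D n) (hDc n)
  obtain ⟨R, hR⟩ := (hbdd _ (hdc 0)).exists_norm_le
  obtain ⟨z, φ, hφ, hz⟩ := hE x R fun n => hR _ (hDd n 0 (Nat.zero_le n) (hx n))
  have hzd : ∀ i, z ∈ d i := fun i =>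
    (hconv _ (hdc i)).mem_of_weak_tendsto (hcl _ (hdc i))
      ((eventually_ge_atTop i).mono fun n hn => hDd _ i (hn.trans (hφ.id_le n)) (hx _)) hz
  refine ⟨z, fun A hA => ?_⟩
  by_contra hzA
  have : z ∈ ⋃₀ T := hTU ▸ ⟨Aᶜ, ⟨A, hA, rfl⟩, hzA⟩
  obtain ⟨U, hU, hzU⟩ := this
  have hUr : Uᶜ ∈ Set.range d := hd ▸ Or.inr ⟨U, hU, rfl⟩
  obtain ⟨i, hi⟩ := hUr
  exact (hi ▸ hzd i : z ∈ Uᶜ) hzU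

/-- The nonempty closed convex subsets of `C` that are invariant under `T`. -/
def invariantClosedConvex (C : Set E) (T : E → E) : Set (Set E) :=
  {D | D ⊆ C ∧ D.Nonempty ∧ IsClosed D ∧ Convex ℝ D ∧ Set.MapsTo T D D}

theorem BoundedWeaklySeqCompact.exists_minimal_invariant [TopologicalSpace.SeparableSpace E]
    (hE : BoundedWeaklySeqCompact E) {C : Set E} (hne : C.Nonempty) (hcl : IsClosed C)
    (hbdd : Bornology.IsBounded C) (hconv : Convex ℝ C) {T : E → E} (hT : Set.MapsTo T C C) :
    ∃ D, Minimal (· ∈ invariantClosedConvex C T) D := by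
  have hchain : ∀ c ⊆ invariantClosedConvex C T, IsChain (· ⊆ ·) c → c.Nonempty →
      ∃ lb ∈ invariantClosedConvex C T, ∀ D ∈ c, lb ⊆ D := by
    intro c hcS hc hcne
    refine ⟨⋂₀ c, ⟨?_, ?_, ?_, ?_, ?_⟩, fun D hD => Set.sInter_subset_of_mem hD⟩
    · obtain ⟨D, hD⟩ := hcne
      exact (Set.sInter_subset_of_mem hD).trans (hcS hD).1
    · exact hE.nonempty_sInter hc hcne (fun D hD => (hcS hD).2.1) (fun D hD => (hcS hD).2.2.1)
        (fun D hD => hbdd.subset (hcS hD).1) (fun D hD => (hcS hD).2.2.2.1)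
    · exact isClosed_sInter fun D hD => (hcS hD).2.2.1
    · exact convex_sInter fun D hD => (hcS hD).2.2.2.1
    · exact fun x hx D hD => (hcS hD).2.2.2.2 (hx D hD)
  obtain ⟨D, -, hD⟩ := zorn_superset_nonempty (invariantClosedConvex C T) hchain C
    ⟨subset_rfl, hne, hcl, hconv, hT⟩
  exact ⟨D, hD⟩

/-- Kirk's lemma: a minimal invariant set of a nonexpansive map contained in a ball centred at one
of its points is contained in the ball of the same radius centred at any of its points. -/
theorem Minimal.norm_sub_le_of_subset_closedBall {C K : Set E} {T : E → E}
    (hne : ∀ x ∈ C, ∀ y ∈ C, ‖T x - T y‖ ≤ ‖x - y‖)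
    (hK : Minimal (· ∈ invariantClosedConvex C T) K) {z : E} {r : ℝ} (hz : z ∈ K)
    (hzr : ∀ y ∈ K, ‖y - z‖ ≤ r) : ∀ x ∈ K, ∀ y ∈ K, ‖y - x‖ ≤ r := by
  obtain ⟨hKC, -, hKcl, hKconv, hKT⟩ := hK.prop
  have hball : ∀ x ∈ K, (∀ y ∈ K, ‖y - x‖ ≤ r) → ∀ y ∈ K, ‖y - T x‖ ≤ r := by
    intro x hx hxr
    have hA : K ∩ Metric.closedBall (T x) r ∈ invariantClosedConvex C T := by
      have hmaps : ∀ y ∈ K, T y ∈ K ∩ Metric.closedBall (T x) r := fun y hy =>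
        ⟨hKT hy, by
          rw [Metric.mem_closedBall, dist_eq_norm]
          exact (hne y (hKC hy) x (hKC hx)).trans (hxr y hy)⟩
      exact ⟨Set.inter_subset_left.trans hKC, ⟨T x, hmaps x hx⟩,
        hKcl.inter Metric.isClosed_closedBall, hKconv.inter (convex_closedBall _ _),
        fun y hy => hmaps y hy.1⟩
    intro y hy
    have := (hK.le_of_le hA Set.inter_subset_left hy).2
    rwa [Metric.mem_closedBall, dist_eq_norm] at this
  have hW : K ∩ ⋂ y ∈ K, Metric.closedBall y r ∈ invariantClosedConvex C T := by
    refine ⟨Set.inter_subset_left.trans hKC, ⟨z, hz, ?_⟩, ?_, ?_, ?_⟩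
    · simpa [dist_eq_norm, norm_sub_rev] using hzr
    · exact hKcl.inter (isClosed_biInter fun y _ => Metric.isClosed_closedBall)
    · exact hKconv.inter (convex_iInter₂ fun y _ => convex_closedBall _ _)
    · rintro x ⟨hx, hxr⟩
      simp only [Set.mem_iInter, Metric.mem_closedBall, dist_eq_norm] at hxr
      refine ⟨hKT hx, ?_⟩
      simp only [Set.mem_iInter, Metric.mem_closedBall, dist_eq_norm]
      intro y hy
      rw [norm_sub_rev]
      exact hball x hx (fun y hy => by rw [norm_sub_rev]; exact hxr y hy) y hy
  intro x hx y hy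
  have := (hK.le_of_le hW Set.inter_subset_left hx).2
  simp only [Set.mem_iInter, Metric.mem_closedBall, dist_eq_norm] at this
  rw [norm_sub_rev]
  exact this y hy

/-- A separable convex set all of whose points are diametral contains a sequence whose distances to
every point of the set tend to the diameter. -/
theorem exists_seq_tendsto_norm_sub [TopologicalSpace.SeparableSpace E] {K : Set E}
    (hne : K.Nonempty) (hconv : Convex ℝ K) {d : ℝ} (hd : ∀ x ∈ K, ∀ y ∈ K, ‖y - x‖ ≤ d)
    (hdiam : ∀ z ∈ K, ∀ r < d, ∃ y ∈ K, r < ‖y - z‖) :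
    ∃ x : ℕ → E, (∀ n, x n ∈ K) ∧ ∀ y ∈ K, Tendsto (fun n => ‖x n - y‖) atTop (𝓝 d) := by
  have : SecondCountableTopology E := UniformSpace.secondCountable_of_separable E
  have : Nonempty K := hne.to_subtype
  set p : ℕ → K := TopologicalSpace.denseSeq K with hp
  have hmean : ∀ n : ℕ, ∑ i ∈ Finset.range (n + 1), ((n + 1 : ℝ)⁻¹) • (p i : E) ∈ K := fun n =>
    hconv.sum_mem (fun i _ => by positivity)
      (by simp only [Finset.sum_const, Finset.card_range, nsmul_eq_mul]; push_cast; field_simp)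
      (fun i _ => (p i).2)
  choose x hxK hx using fun n : ℕ => hdiam _ (hmean n) (d - ((n + 1 : ℝ)⁻¹) ^ 2)
    (sub_lt_self _ (by positivity))
  have hlow : ∀ n k : ℕ, k ≤ n → d - (n + 1 : ℝ)⁻¹ ≤ ‖x n - p k‖ := by
    intro n k hkn
    have hn0 : (0 : ℝ) < n + 1 := by positivity
    have hsum : x n - ∑ i ∈ Finset.range (n + 1), ((n + 1 : ℝ)⁻¹) • (p i : E)
        = ((n + 1 : ℝ)⁻¹) • ∑ i ∈ Finset.range (n + 1), (x n - p i) := by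
      rw [← Finset.smul_sum, Finset.sum_sub_distrib, smul_sub, Finset.sum_const,
        Finset.card_range, ← Nat.cast_smul_eq_nsmul ℝ, smul_smul]
      push_cast
      rw [inv_mul_cancel₀ hn0.ne', one_smul]
    have hle : ‖∑ i ∈ Finset.range (n + 1), (x n - (p i : E))‖ ≤ ‖x n - p k‖ + n * d := by
      refine (norm_sum_le _ _).trans ?_
      have hk : k ∈ Finset.range (n + 1) := Finset.mem_range.2 (Nat.lt_succ_of_le hkn)
      rw [← Finset.add_sum_erase _ _ hk]
      gcongr
      refine (Finset.sum_le_card_nsmul _ _ d fun i _ => hd _ (p i).2 _ (hxK n)).trans_eq ?_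
      rw [Finset.card_erase_of_mem hk, Finset.card_range, nsmul_eq_mul]
      simp
    have h := hx n
    rw [hsum, norm_smul, norm_inv, Real.norm_of_nonneg hn0.le] at h
    have h' := mul_lt_mul_of_pos_left h hn0
    rw [mul_inv_cancel_left₀ hn0.ne', mul_sub, sq, mul_inv_cancel_left₀ hn0.ne'] at h'
    linarith
  refine ⟨x, hxK, fun y hy => ?_⟩
  rw [Metric.tendsto_atTop]
  intro ε hε
  obtain ⟨k, hk⟩ := (TopologicalSpace.denseRange_denseSeq K).exists_dist_lt ⟨y, hy⟩ (half_pos hε)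
  obtain ⟨m, hm⟩ := exists_nat_one_div_lt (half_pos hε)
  refine ⟨max k m, fun n hn => ?_⟩
  have h1 := hlow n k (le_of_max_le_left hn)
  have h2 : (n + 1 : ℝ)⁻¹ < ε / 2 := by
    rw [one_div] at hm
    refine lt_of_le_of_lt ?_ hm
    have : (m : ℝ) ≤ n := by exact_mod_cast le_of_max_le_right hn
    gcongr
  have h3 : ‖y - p k‖ < ε / 2 := by
    rwa [Subtype.dist_eq, dist_eq_norm] at hk
  have h4 : ‖x n - p k‖ ≤ ‖x n - y‖ + ‖y - p k‖ := norm_sub_le_norm_sub_add_norm_sub _ _ _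
  have h5 := hd y hy _ (hxK n)
  rw [Real.dist_eq, abs_lt]
  constructor <;> linarith

/-- A bounded convex closed set with at least two points has a nondiametral point. -/
theorem EventualPropertyM.exists_nondiametral [TopologicalSpace.SeparableSpace E]
    (hM : EventualPropertyM E) (hE : BoundedWeaklySeqCompact E) {K : Set E} (hne : K.Nonempty)
    (hcl : IsClosed K) (hconv : Convex ℝ K) {d : ℝ} (hd0 : 0 < d)
    (hd : ∀ x ∈ K, ∀ y ∈ K, ‖y - x‖ ≤ d) :
    ∃ z ∈ K, ∃ r < d, ∀ y ∈ K, ‖y - z‖ ≤ r := by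
  by_contra! hdiam
  obtain ⟨x, hxK, hx⟩ := exists_seq_tendsto_norm_sub hne hconv hd hdiam
  obtain ⟨a, ha⟩ := hne
  obtain ⟨z, φ, hφ, hz⟩ := hE x (d + ‖a‖) fun n => by
    have := norm_le_norm_sub_add (x n) a
    linarith [hd a ha _ (hxK n)]
  have hzK : z ∈ K := hconv.mem_of_weak_tendsto hcl (.of_forall fun n => hxK (φ n)) hz
  set w : ℕ → E := fun n => d⁻¹ • (x (φ n) - z) with hw
  have hwnull : WeakNull w := fun f => by
    simpa [hw] using ((hz f).sub_const (f z)).const_mul d⁻¹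
  have hnorm : ∀ v : E, ‖d⁻¹ • v‖ = d⁻¹ * ‖v‖ := fun v => by
    rw [norm_smul, norm_inv, Real.norm_of_nonneg hd0.le]
  have hw1 : Tendsto (fun n => ‖w n‖) atTop (𝓝 1) := by
    simp only [hw, hnorm]
    simpa [hd0.ne'] using ((hx z hzK).comp hφ.tendsto_atTop).const_mul d⁻¹
  refine hE.false_of_absorbed hwnull hw1 fun u hu c hc => ?_
  obtain ⟨m, hm⟩ := (hw1.eventually (lt_mem_nhds hu)).exists
  refine hM w hwnull u (-w m) (by rw [norm_neg]; exact hm.le) 1 c hc (.of_forall fun n => ?_)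
  have : w n + -w m = d⁻¹ • (x (φ n) - x (φ m)) := by
    rw [← sub_eq_add_neg, hw, ← smul_sub, sub_sub_sub_cancel_right]
  rw [this, hnorm, inv_mul_le_one₀ hd0]
  exact hd _ (hxK _) _ (hxK _)

theorem EventualPropertyM.fpp [TopologicalSpace.SeparableSpace E]
    (hM : EventualPropertyM E) (hE : BoundedWeaklySeqCompact E) : FPP E := by
  intro C hne hcl hbdd hconv T hT hnonexp
  obtain ⟨K, hK⟩ := hE.exists_minimal_invariant hne hcl hbdd hconv hT
  obtain ⟨hKC, ⟨x, hx⟩, hKcl, hKconv, hKT⟩ := hK.prop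
  have hKbdd := hbdd.subset hKC
  have hd : ∀ x ∈ K, ∀ y ∈ K, ‖y - x‖ ≤ Metric.diam K := fun x hx y hy => by
    rw [← dist_eq_norm]
    exact Metric.dist_le_diam_of_mem hKbdd hy hx
  rcases Metric.diam_nonneg.eq_or_lt (a := (0 : ℝ)) (b := Metric.diam K) with h0 | h0
  · refine ⟨x, hKC hx, ?_⟩
    have := hd x hx _ (hKT hx)
    rw [← h0] at this
    exact sub_eq_zero.1 (norm_le_zero_iff.1 this)
  · obtain ⟨z, hz, r, hr, hzr⟩ := hM.exists_nondiametral hE ⟨x, hx⟩ hKcl hKconv h0 hd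
    have hle := Minimal.norm_sub_le_of_subset_closedBall hnonexp hK hz hzr
    have hr0 : 0 ≤ r := (norm_nonneg _).trans (hzr z hz)
    refine absurd (Metric.diam_le_of_forall_dist_le hr0 fun y hy x hx => ?_) hr.not_ge
    rw [dist_eq_norm]
    exact hle x hx y hy

end

theorem stmt16 (X : Type*) [NormedAddCommGroup X] [NormedSpace ℝ X] [CompleteSpace X]
    [TopologicalSpace.SeparableSpace X]
    (hM : PropertyMStar X) (hr : IsReflexive X) :
    FPP X ∧ FPP (X →L[ℝ] ℝ) := by
  have := hr.separableSpace_dual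
  exact ⟨hM.eventualPropertyM.fpp hr.boundedWeaklySeqCompact,
    hM.eventualPropertyM_dual.fpp hr.boundedWeaklySeqCompact_dual⟩
end
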